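/- arXiv:0905.0270 — 3 statements merged into one kernel-verified Lean document; each statement's English description precedes it below -/
import Mathlib

section
/- Let d ≥ 3 and 0 < q < d/2. There exist constants c₀, c₁ > 0, depending only on d and q, such that for every V : ℤ^d → [0,∞) one has, in [0,∞], c₀ · sup_{s>0} ( s^q ν(s,V) ) ≤ sup_{s>0} ( s^q n(s,V) ) ≤ c₁ · sup_{s>0} ( s^q ν(s,V) ). In particular, sup_{s>0} s^q n(s,V) is finite if and only if sup_{s>0} s^q ν(s,V) is finite, i.e. N₋(H_{αV}) = O(α^q) as α → ∞ if and only if V ∈ ℓ_{q,w}(ℤ^d). -/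
open scoped ENNReal NNReal Topology
open Filter MeasureTheory

noncomputable section

/-- The lattice point `1_j` in `ℤ^d`: `j`-th coordinate `1`, all others `0`. -/
def latUnit (d : ℕ) (j : Fin d) : Fin d → ℤ := fun i => if i = j then 1 else 0

/-- The discrete Dirichlet form `Q_0[u] = Σ_x Σ_j |u(x+1_j) − u(x)|²`, valued in `[0,∞]`. -/
def Q0 {d : ℕ} (u : (Fin d → ℤ) → ℂ) : ℝ≥0∞ :=
  ∑' x : Fin d → ℤ, ∑ j : Fin d, ((‖u (x + latUnit d j) - u x‖₊ : ℝ≥0∞)) ^ 2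

/-- `b_V[u] = Σ_x V(x)|u(x)|²`, valued in `[0,∞]`. -/
def bV {d : ℕ} (V : (Fin d → ℤ) → ℝ) (u : (Fin d → ℤ) → ℂ) : ℝ≥0∞ :=
  ∑' x : Fin d → ℤ, ENNReal.ofReal (V x) * ((‖u x‖₊ : ℝ≥0∞)) ^ 2

/-- The Euclidean norm `|x|` of a lattice point. -/
def znorm {d : ℕ} (x : Fin d → ℤ) : ℝ := Real.sqrt (∑ i, ((x i : ℝ)) ^ 2)

/-- The counting function `n(s,V)`: the supremum, in `ℕ∞`, of `dim L` over all
finite-dimensional subspaces `L` of the space of finitely supported functions with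
`b_V[u] > s·Q_0[u]` for all nonzero `u ∈ L` (the `s`-admissible subspaces). -/
def nCount (d : ℕ) (V : (Fin d → ℤ) → ℝ) (s : ℝ) : ℕ∞ :=
  ⨆ L : {L : Submodule ℂ ((Fin d → ℤ) → ℂ) //
      (∀ u ∈ L, (Function.support u).Finite) ∧ FiniteDimensional ℂ L ∧
      ∀ u ∈ L, u ≠ 0 → ENNReal.ofReal s * Q0 u < bV V u},
    (Module.finrank ℂ L.1 : ℕ∞)

/-- `ν(s,V)`: the number (in `ℕ∞`) of lattice points with `V(x) > s`. -/
def nuCount (d : ℕ) (V : (Fin d → ℤ) → ℝ) (s : ℝ) : ℕ∞ :=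
  {x : Fin d → ℤ | s < V x}.encard

/-- The `ℓ²` norm of a function on the lattice, valued in `[0,∞]`. -/
def l2norm {d : ℕ} (u : (Fin d → ℤ) → ℂ) : ℝ≥0∞ := eLpNorm u 2 Measure.count

lemma eLpNorm_two_count_sq {α : Type*} [MeasurableSpace α] [MeasurableSingletonClass α]
    (u : α → ℂ) : eLpNorm u 2 Measure.count ^ 2 = ∑' x, ‖u x‖ₑ ^ 2 := by
  have h := eLpNorm_nnreal_pow_eq_lintegral (f := u) (μ := Measure.count) (p := 2) (by norm_num)
  rw [lintegral_count] at h
  simpa using h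

lemma l2norm_sq {d : ℕ} (u : (Fin d → ℤ) → ℂ) : l2norm u ^ 2 = ∑' x, ‖u x‖ₑ ^ 2 :=
  eLpNorm_two_count_sq u

lemma eLpNorm_two_count_lt_top {α : Type*} [MeasurableSpace α] [MeasurableSingletonClass α]
    {u : α → ℂ} (hu : (Function.support u).Finite) : eLpNorm u 2 Measure.count < ⊤ := by
  have h : eLpNorm u 2 Measure.count ^ 2 ≠ ⊤ := by
    rw [eLpNorm_two_count_sq, tsum_eq_sum (s := hu.toFinset)]
    · exact (ENNReal.sum_lt_top.2 fun x _ => by finiteness).ne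
    · intro x hx
      simp only [Set.Finite.mem_toFinset, Function.mem_support, not_not] at hx
      simp [hx]
  rw [lt_top_iff_ne_top]
  rintro h'
  simp [h'] at h

lemma l2norm_add_le {d : ℕ} (u v : (Fin d → ℤ) → ℂ) : l2norm (u + v) ≤ l2norm u + l2norm v :=
  eLpNorm_add_le .of_discrete .of_discrete (by norm_num)

lemma l2norm_sub_le {d : ℕ} (u v : (Fin d → ℤ) → ℂ) : l2norm (u - v) ≤ l2norm u + l2norm v :=
  eLpNorm_sub_le .of_discrete .of_discrete (by norm_num)

lemma l2norm_sub_comm {d : ℕ} (u v : (Fin d → ℤ) → ℂ) : l2norm (u - v) = l2norm (v - u) := by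
  unfold l2norm; rw [← eLpNorm_neg, neg_sub]

lemma l2norm_translate {d : ℕ} (u : (Fin d → ℤ) → ℂ) (a : Fin d → ℤ) :
    l2norm (fun x => u (x + a)) = l2norm u :=
  eLpNorm_comp_measurePreserving (f := fun x => x + a) (g := u) .of_discrete
    (measurePreserving_add_right _ a)

lemma Q0_eq_sum {d : ℕ} (u : (Fin d → ℤ) → ℂ) :
    Q0 u = ∑ j : Fin d, l2norm (fun x => u (x + latUnit d j) - u x) ^ 2 := by
  unfold Q0
  rw [Summable.tsum_finsetSum fun _ _ => ENNReal.summable]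
  simp_rw [l2norm_sq]
  rfl

lemma l2norm_unit_diff_le {d : ℕ} (u : (Fin d → ℤ) → ℂ) (j : Fin d) :
    l2norm (fun x => u (x + latUnit d j) - u x) ≤ Q0 u ^ (1 / 2 : ℝ) := by
  rw [one_div, ENNReal.le_rpow_inv_iff (by norm_num), Q0_eq_sum]
  simpa using Finset.single_le_sum
    (f := fun j => l2norm (fun x => u (x + latUnit d j) - u x) ^ 2)
    (fun _ _ => zero_le) (Finset.mem_univ j)

lemma Q0_le_l2norm_sq {d : ℕ} (u : (Fin d → ℤ) → ℂ) : Q0 u ≤ 4 * d * l2norm u ^ 2 := by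
  rw [Q0_eq_sum]
  calc _ ≤ ∑ j : Fin d, (4 : ℝ≥0∞) * l2norm u ^ 2 := by
        refine Finset.sum_le_sum fun j _ => ?_
        have h := l2norm_sub_le (fun x => u (x + latUnit d j)) u
        rw [l2norm_translate] at h
        calc _ ≤ (l2norm u + l2norm u) ^ 2 := by gcongr; exact h
          _ = _ := by ring
    _ = _ := by simp; ring

lemma l2norm_translate_add_diff {d : ℕ} (u : (Fin d → ℤ) → ℂ) (a b : Fin d → ℤ) :
    l2norm (fun x => u (x + (a + b)) - u x) ≤
      l2norm (fun x => u (x + a) - u x) + l2norm (fun x => u (x + b) - u x) := by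
  rw [← l2norm_translate (fun x => u (x + a) - u x) b]
  refine le_of_eq_of_le (congrArg _ ?_) (l2norm_add_le _ _)
  ext x
  simp only [Pi.add_apply]
  rw [show x + (a + b) = x + b + a by abel]
  ring

lemma l2norm_translate_diff_le {d : ℕ} (u : (Fin d → ℤ) → ℂ) (h : Fin d → ℕ) :
    l2norm (fun x => u (x + fun i => (h i : ℤ)) - u x) ≤
      (∑ j, (h j : ℝ≥0∞)) * Q0 u ^ (1 / 2 : ℝ) := by
  have h0 : l2norm (fun x => u (x + 0) - u x) = 0 := by
    simp only [add_zero, sub_self]; exact eLpNorm_zero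
  have h1 (j : Fin d) (n : ℕ) :
      l2norm (fun x => u (x + n • latUnit d j) - u x) ≤ n * Q0 u ^ (1 / 2 : ℝ) := by
    induction n with
    | zero => simp only [zero_smul, h0]; simp
    | succ n ih =>
      rw [succ_nsmul]
      refine (l2norm_translate_add_diff _ _ _).trans ?_
      refine (add_le_add ih (l2norm_unit_diff_le u j)).trans ?_
      push_cast; rw [add_mul, one_mul]
  have h2 (s : Finset (Fin d)) : l2norm (fun x => u (x + ∑ j ∈ s, h j • latUnit d j) - u x) ≤
      (∑ j ∈ s, (h j : ℝ≥0∞)) * Q0 u ^ (1 / 2 : ℝ) := by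
    induction s using Finset.induction_on with
    | empty => simp only [Finset.sum_empty, h0]; simp
    | insert j s hj ih =>
      rw [Finset.sum_insert hj, Finset.sum_insert hj, add_mul]
      exact (l2norm_translate_add_diff _ _ _).trans (add_le_add (h1 j _) ih)
  convert h2 Finset.univ using 6
  ext i
  simp [latUnit, Finset.sum_apply]

/-- The average of `u` over the cube `x + {0, …, R - 1}^d`. -/
def cubeAvg {d : ℕ} (R : ℕ) (u : (Fin d → ℤ) → ℂ) : (Fin d → ℤ) → ℂ :=
  fun x => ((R : ℂ) ^ d)⁻¹ * ∑ h : Fin d → Fin R, u (x + fun i => ((h i : ℕ) : ℤ))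

lemma cubeAvg_sub {d : ℕ} (R : ℕ) (u v : (Fin d → ℤ) → ℂ) :
    cubeAvg R (u - v) = cubeAvg R u - cubeAvg R v := by
  ext x; simp [cubeAvg, mul_sub, Finset.sum_sub_distrib]

lemma cubeAvg_comm {d : ℕ} (R S : ℕ) (u : (Fin d → ℤ) → ℂ) :
    cubeAvg R (cubeAvg S u) = cubeAvg S (cubeAvg R u) := by
  ext x
  simp only [cubeAvg, Finset.mul_sum]
  rw [Finset.sum_comm]
  refine Finset.sum_congr rfl fun h _ => Finset.sum_congr rfl fun k _ => ?_
  rw [add_right_comm]; ring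

lemma cubeAvg_one {d : ℕ} (u : (Fin d → ℤ) → ℂ) : cubeAvg 1 u = u := by
  ext x
  simp only [cubeAvg, Nat.cast_one, one_pow, inv_one, one_mul, Finset.univ_unique,
    Finset.sum_singleton]
  congr 1
  ext i
  simp

lemma l2norm_sub_cubeAvg_le {d : ℕ} {R : ℕ} (hR : R ≠ 0) (u : (Fin d → ℤ) → ℂ) :
    l2norm (u - cubeAvg R u) ≤ d * R * Q0 u ^ (1 / 2 : ℝ) := by
  have hR' : (R : ℂ) ^ d ≠ 0 := pow_ne_zero _ (by exact_mod_cast hR)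
  have hc : ((R : ℂ) ^ d)⁻¹ • ∑ h : Fin d → Fin R, (fun x => u (x + fun i => ((h i : ℕ) : ℤ)) - u x)
      = cubeAvg R u - u := by
    ext x
    simp [cubeAvg, Finset.sum_apply, mul_sub, hR']
  rw [l2norm_sub_comm, ← hc]
  unfold l2norm
  rw [eLpNorm_const_smul]
  calc _ ≤ ‖((R : ℂ) ^ d)⁻¹‖ₑ * ∑ h : Fin d → Fin R, (d * R * Q0 u ^ (1 / 2 : ℝ)) := by
        gcongr
        refine (eLpNorm_sum_le (fun _ _ => .of_discrete) (by norm_num)).trans ?_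
        refine Finset.sum_le_sum fun h _ => ?_
        refine (l2norm_translate_diff_le u fun i => (h i : ℕ)).trans ?_
        gcongr
        calc _ ≤ ∑ j : Fin d, (R : ℝ≥0∞) :=
              Finset.sum_le_sum fun j _ => by exact_mod_cast (h j).2.le
          _ = _ := by simp
    _ = _ := by
        rw [enorm_inv hR', Finset.sum_const, nsmul_eq_mul, ← mul_assoc]
        have : ‖(R : ℂ) ^ d‖ₑ = (R : ℝ≥0∞) ^ d := by
          rw [enorm_pow]; congr 1; simp [← ofReal_norm]
        rw [this]
        simp only [Finset.card_univ, Fintype.card_fun, Fintype.card_fin, Nat.cast_pow]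
        rw [ENNReal.inv_mul_cancel (by simp [hR]) (by finiteness), one_mul]

lemma enorm_cubeAvg_sq_le {d : ℕ} {R : ℕ} (hR : R ≠ 0) (v : (Fin d → ℤ) → ℂ) (x : Fin d → ℤ) :
    ‖cubeAvg R v x‖ₑ ^ 2 ≤ ((R : ℝ≥0∞) ^ d)⁻¹ * l2norm v ^ 2 := by
  have hR' : (R : ℂ) ^ d ≠ 0 := pow_ne_zero _ (by exact_mod_cast hR)
  have h1 : ‖∑ h : Fin d → Fin R, v (x + fun i => ((h i : ℕ) : ℤ))‖ₑ ^ 2 ≤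
      (R : ℝ≥0∞) ^ d * ∑ h : Fin d → Fin R, ‖v (x + fun i => ((h i : ℕ) : ℤ))‖ₑ ^ 2 := by
    have : ‖∑ h : Fin d → Fin R, v (x + fun i => ((h i : ℕ) : ℤ))‖₊ ^ 2 ≤
      (R : ℝ≥0) ^ d * ∑ h : Fin d → Fin R, ‖v (x + fun i => ((h i : ℕ) : ℤ))‖₊ ^ 2 := by
      refine (pow_le_pow_left₀ zero_le (nnnorm_sum_le _ _) 2).trans ?_
      refine sq_sum_le_card_mul_sum_sq.trans ?_
      simp
    simp only [enorm_eq_nnnorm]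
    exact_mod_cast this
  have h2 : ∑ h : Fin d → Fin R, ‖v (x + fun i => ((h i : ℕ) : ℤ))‖ₑ ^ 2 ≤ l2norm v ^ 2 := by
    rw [l2norm_sq, ← tsum_fintype (L := .unconditional _)]
    refine ENNReal.tsum_comp_le_tsum_of_injective
      (f := fun h : Fin d → Fin R => x + fun i => ((h i : ℕ) : ℤ)) ?_ (fun y => ‖v y‖ₑ ^ 2)
    intro h k hk
    ext i
    simpa using congrFun hk i
  have h3 : ‖(R : ℂ) ^ d‖ₑ = (R : ℝ≥0∞) ^ d := by
    rw [enorm_pow]; congr 1; simp [← ofReal_norm]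
  unfold cubeAvg
  rw [enorm_mul, mul_pow, enorm_inv hR', h3]
  calc _ ≤ ((R : ℝ≥0∞) ^ d)⁻¹ ^ 2 * ((R : ℝ≥0∞) ^ d * l2norm v ^ 2) := by
        gcongr; exact h1.trans (by gcongr)
    _ = ((R : ℝ≥0∞) ^ d)⁻¹ * (((R : ℝ≥0∞) ^ d)⁻¹ * (R : ℝ≥0∞) ^ d) * l2norm v ^ 2 := by ring
    _ = _ := by rw [ENNReal.inv_mul_cancel (by simp [hR]) (by finiteness), mul_one]

lemma ENNReal.rpow_half_sq (x : ℝ≥0∞) : (x ^ (1 / 2 : ℝ)) ^ 2 = x := by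
  rw [← ENNReal.rpow_mul_natCast]; norm_num

/-- In dimension at least three, cube averages over cubes of side `R = 2 ^ l` are bounded
functionals in the Dirichlet norm, with squared norm of order `R ^ (2 - d)`. -/
lemma exists_enorm_cubeAvg_sq_le {d : ℕ} (hd : 3 ≤ d) :
    ∃ K : ℝ≥0∞, K ≠ ⊤ ∧ ∀ u : (Fin d → ℤ) → ℂ, (Function.support u).Finite →
      ∀ (l : ℕ) (x : Fin d → ℤ),
        ‖cubeAvg (2 ^ l) u x‖ₑ ^ 2 ≤ K * (4 * (2 ^ d)⁻¹) ^ l * Q0 u := by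
  set θ : ℝ≥0∞ := ((2 : ℝ≥0∞) ^ d)⁻¹ ^ (1 / 2 : ℝ) with hθ
  have hθ2 : θ ^ 2 = ((2 : ℝ≥0∞) ^ d)⁻¹ := ENNReal.rpow_half_sq _
  have h8 : (4 : ℝ≥0∞) * (2 ^ d)⁻¹ < 1 := by
    rw [← div_eq_mul_inv, ENNReal.div_lt_iff (by simp) (by simp), one_mul]
    calc (4 : ℝ≥0∞) < 2 ^ 3 := by norm_num
      _ ≤ 2 ^ d := pow_le_pow_right₀ (by norm_num) hd
  have hr2 : (2 * θ) ^ 2 = 4 * (2 ^ d)⁻¹ := by rw [mul_pow, hθ2]; norm_num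
  have hr : 2 * θ < 1 := by
    rw [← hr2] at h8
    exact (pow_lt_one_iff (two_ne_zero)).1 h8
  have hθ1 : θ ≤ 1 := le_trans (by rw [two_mul]; exact le_self_add) hr.le
  have hpt (v : (Fin d → ℤ) → ℂ) (l : ℕ) (x) : ‖cubeAvg (2 ^ l) v x‖ₑ ≤ θ ^ l * l2norm v := by
    refine (ENNReal.pow_le_pow_left_iff two_ne_zero).1 ?_
    refine (enorm_cubeAvg_sq_le (by positivity) v x).trans_eq ?_
    rw [mul_pow, ← pow_mul, mul_comm l 2, pow_mul, hθ2, ← ENNReal.inv_pow]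
    congr 2
    push_cast
    rw [← pow_mul, ← pow_mul, mul_comm]
  refine ⟨(3 * d / (1 - 2 * θ)) ^ 2, ?_, ?_⟩
  · refine ENNReal.pow_ne_top (ENNReal.div_ne_top (by finiteness) ?_)
    exact (tsub_pos_of_lt hr).ne'
  intro u hu l x
  set P := Q0 u ^ (1 / 2 : ℝ) with hP
  have hP2 : P ^ 2 = Q0 u := ENNReal.rpow_half_sq _
  have hN : l2norm u < ⊤ := eLpNorm_two_count_lt_top hu
  have hstep (n : ℕ) : edist (cubeAvg (2 ^ n) u x) (cubeAvg (2 ^ (n + 1)) u x) ≤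
      3 * d * P * (2 * θ) ^ n := by
    set A := cubeAvg (2 ^ n) u
    set B := cubeAvg (2 ^ (n + 1)) u
    have e1 : ‖A x - cubeAvg (2 ^ n) B x‖ₑ ≤ θ ^ n * (d * 2 ^ (n + 1) * P) := by
      have := hpt (u - B) n x
      rw [cubeAvg_sub] at this
      refine this.trans ?_
      gcongr
      exact_mod_cast l2norm_sub_cubeAvg_le (R := 2 ^ (n + 1)) (by positivity) u
    have e2 : ‖B x - cubeAvg (2 ^ n) B x‖ₑ ≤ θ ^ (n + 1) * (d * 2 ^ n * P) := by
      have := hpt (u - A) (n + 1) x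
      rw [cubeAvg_sub, cubeAvg_comm] at this
      refine this.trans ?_
      gcongr
      exact_mod_cast l2norm_sub_cubeAvg_le (R := 2 ^ n) (by positivity) u
    rw [edist_eq_enorm_sub, ← sub_sub_sub_cancel_right _ _ (cubeAvg (2 ^ n) B x)]
    calc _ ≤ θ ^ n * (d * 2 ^ (n + 1) * P) + θ ^ (n + 1) * (d * 2 ^ n * P) :=
          enorm_sub_le.trans (add_le_add e1 e2)
      _ ≤ θ ^ n * (d * 2 ^ (n + 1) * P) + θ ^ n * 1 * (d * 2 ^ n * P) := by
          rw [pow_succ θ]; gcongr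
      _ = _ := by rw [mul_pow]; ring
  have hlim : Tendsto (fun n => cubeAvg (2 ^ n) u x) atTop (𝓝 0) := by
    rw [tendsto_iff_edist_tendsto_0]
    have : Tendsto (fun n => θ ^ n * l2norm u) atTop (𝓝 (0 * l2norm u)) := by
      refine ENNReal.Tendsto.mul_const (ENNReal.tendsto_pow_atTop_nhds_zero_of_lt_one ?_)
        (.inr hN.ne)
      exact lt_of_le_of_lt (by rw [two_mul]; exact le_self_add) hr
    rw [zero_mul] at this
    refine tendsto_of_tendsto_of_tendsto_of_le_of_le tendsto_const_nhds this
      (fun _ => zero_le) fun n => ?_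
    simpa [edist_zero_right] using hpt u n x
  have key := edist_le_of_edist_le_geometric_of_tendsto (2 * θ) _ hstep hlim l
  rw [edist_zero_right] at key
  calc _ ≤ (3 * d * P * (2 * θ) ^ l / (1 - 2 * θ)) ^ 2 := by gcongr
    _ = _ := by
      rw [← hr2, ← hP2]; generalize 2 * θ = w; simp only [div_eq_mul_inv]; ring

lemma exists_bessel_family {E H : Type*} [AddCommGroup E] [Module ℂ E] [FiniteDimensional ℂ E]
    [NormedAddCommGroup H] [InnerProductSpace ℂ H] (D : E →ₗ[ℂ] H)
    (hD : Function.Injective D) :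
    ∃ u : Fin (Module.finrank ℂ E) → E, (∀ i, ‖D (u i)‖ₑ = 1) ∧
      ∀ (φ : E →ₗ[ℂ] ℂ) (κ : ℝ≥0∞), (∀ v, ‖φ v‖ₑ ^ 2 ≤ κ * ‖D v‖ₑ ^ 2) →
        ∑ i, ‖φ (u i)‖ₑ ^ 2 ≤ κ := by
  have hfr : Module.finrank ℂ (LinearMap.range D) = Module.finrank ℂ E :=
    LinearMap.finrank_range_of_inj hD
  let b := (stdOrthonormalBasis ℂ (LinearMap.range D)).reindex (finCongr hfr)
  choose u hu using fun i => (b i).2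
  have hon : Orthonormal ℂ fun i => D (u i) := by
    have h := b.orthonormal.comp_linearIsometry (LinearMap.range D).subtypeₗᵢ
    convert h using 2 with i
    exact hu i
  refine ⟨u, fun i => ?_, fun φ κ hκ => ?_⟩
  · rw [← ofReal_norm, hon.1 i, ENNReal.ofReal_one]
  by_cases htop : κ = ⊤
  · simp [htop]
  lift κ to ℝ≥0 using htop
  have hκ' (v : E) : ‖φ v‖ ^ 2 ≤ κ * ‖D v‖ ^ 2 := by
    have := hκ v
    simp only [enorm_eq_nnnorm] at this
    exact_mod_cast this
  have hmain : ∑ i, ‖φ (u i)‖ ^ 2 ≤ κ := by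
    set S := ∑ i, ‖φ (u i)‖ ^ 2 with hS
    have hS0 : 0 ≤ S := by positivity
    have h1 : φ (∑ i, star (φ (u i)) • u i) = S := by
      simp only [map_sum, map_smul, smul_eq_mul, hS]
      push_cast
      refine Finset.sum_congr rfl fun i _ => ?_
      exact RCLike.conj_mul _
    have h2 : ‖D (∑ i, star (φ (u i)) • u i)‖ ^ 2 = S := by
      simp only [map_sum, map_smul]
      rw [hS, ← inner_self_eq_norm_sq (𝕜 := ℂ), hon.inner_sum]
      simp [RCLike.mul_conj, ← Complex.ofReal_pow]
    have h3 := hκ' (∑ i, star (φ (u i)) • u i)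
    rw [h1, h2, Complex.norm_real, Real.norm_of_nonneg hS0, sq] at h3
    rcases hS0.eq_or_lt with h0 | h0
    · rw [← h0]; exact κ.2
    · exact le_of_mul_le_mul_right h3 h0
  simp only [enorm_eq_nnnorm]
  have hmain' : ∑ i, ‖φ (u i)‖₊ ^ 2 ≤ κ := by rw [← NNReal.coe_le_coe]; push_cast; exact hmain
  exact_mod_cast hmain'

lemma eLpNorm_grad_sq {d : ℕ} (u : (Fin d → ℤ) → ℂ) :
    eLpNorm (fun p : (Fin d → ℤ) × Fin d => u (p.1 + latUnit d p.2) - u p.1) 2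
      Measure.count ^ 2 = Q0 u := by
  rw [eLpNorm_two_count_sq, ENNReal.tsum_prod']
  simp_rw [tsum_fintype]
  rfl

lemma memLp_grad {d : ℕ} {u : (Fin d → ℤ) → ℂ} (hu : (Function.support u).Finite) :
    MemLp (fun p : (Fin d → ℤ) × Fin d => u (p.1 + latUnit d p.2) - u p.1) 2
      Measure.count := by
  refine ⟨.of_discrete, ?_⟩
  have hN : l2norm u < ⊤ := eLpNorm_two_count_lt_top hu
  have h : Q0 u ≠ ⊤ := ((Q0_le_l2norm_sq u).trans_lt (by finiteness)).ne
  rw [← eLpNorm_grad_sq] at h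
  rw [lt_top_iff_ne_top]
  rintro h'
  simp [h'] at h

/-- The discrete gradient as a linear map from a space of finitely supported functions to the
Hilbert space `ℓ²(ℤ^d × {1, …, d})`. -/
def gradMap {d : ℕ} (L : Submodule ℂ ((Fin d → ℤ) → ℂ))
    (hL : ∀ u ∈ L, (Function.support u).Finite) :
    L →ₗ[ℂ] Lp ℂ 2 (Measure.count : Measure ((Fin d → ℤ) × Fin d)) where
  toFun u := (memLp_grad (hL u.1 u.2)).toLp
  map_add' u v := by
    rw [← MemLp.toLp_add]
    congr 1
    ext p
    simp only [Submodule.coe_add, Pi.add_apply]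
    ring
  map_smul' c u := by
    rw [RingHom.id_apply, ← MemLp.toLp_const_smul]
    congr 1
    ext p
    simp only [Submodule.coe_smul, Pi.smul_apply, smul_eq_mul]
    ring

lemma enorm_gradMap_sq {d : ℕ} (L : Submodule ℂ ((Fin d → ℤ) → ℂ))
    (hL : ∀ u ∈ L, (Function.support u).Finite) (u : L) :
    ‖gradMap L hL u‖ₑ ^ 2 = Q0 u.1 := by
  rw [← eLpNorm_grad_sq, ← Lp.enorm_toLp (memLp_grad (hL u.1 u.2))]
  rfl

/-- Evaluation of the cube average at a point, as a linear functional. -/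
def cubeAvgAt {d : ℕ} (R : ℕ) (x : Fin d → ℤ) : ((Fin d → ℤ) → ℂ) →ₗ[ℂ] ℂ where
  toFun u := cubeAvg R u x
  map_add' u v := by simp [cubeAvg, Finset.sum_add_distrib, mul_add]
  map_smul' c u := by simp [cubeAvg, Finset.mul_sum, mul_left_comm]

lemma gradMap_injective {d : ℕ} (hd : 3 ≤ d) (L : Submodule ℂ ((Fin d → ℤ) → ℂ))
    (hL : ∀ u ∈ L, (Function.support u).Finite) : Function.Injective (gradMap L hL) := by
  rw [injective_iff_map_eq_zero]
  intro u hu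
  obtain ⟨K, -, h⟩ := exists_enorm_cubeAvg_sq_le hd
  have hQ : Q0 u.1 = 0 := by rw [← enorm_gradMap_sq L hL u, hu]; simp
  ext x
  have := h u.1 (hL u.1 u.2) 0 x
  rw [hQ, mul_zero, pow_zero, cubeAvg_one] at this
  simpa using this

lemma exists_rpow_mul_lt_one {d : ℕ} {q : ℝ} (hq' : q < (d : ℝ) / 2) :
    ∃ a : ℝ, 0 < a ∧ a < 1 / 4 ∧ a ^ (1 - q) * (4 * (2 ^ d)⁻¹) < 1 := by
  have hc : ContinuousAt (fun a : ℝ => a ^ (1 - q) * (4 * (2 ^ d)⁻¹)) (1 / 4) :=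
    (Real.continuousAt_rpow_const _ _ (.inl (by norm_num))).mul continuousAt_const
  have hv : (1 / 4 : ℝ) ^ (1 - q) * (4 * (2 ^ d)⁻¹) < 1 := by
    have h1 : (1 / 4 : ℝ) ^ (1 - q) * 4 = 2 ^ (2 * q) := by
      rw [one_div, Real.inv_rpow (by norm_num), ← Real.rpow_neg (by norm_num),
        show (4 : ℝ) = 2 ^ (2 : ℝ) by norm_num, ← Real.rpow_mul (by norm_num),
        ← Real.rpow_add (by norm_num)]
      congr 1; ring
    rw [← mul_assoc, h1, ← div_eq_mul_inv, div_lt_one (by positivity), ← Real.rpow_natCast]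
    exact Real.rpow_lt_rpow_of_exponent_lt (by norm_num) (by linarith)
  have h1 := (hc.eventually_lt continuousAt_const hv).filter_mono
    (nhdsWithin_le_nhds (s := Set.Iio (1 / 4)))
  have h2 : ∀ᶠ a in 𝓝[<] (1 / 4 : ℝ), 0 < a :=
    nhdsWithin_le_nhds (lt_mem_nhds (by norm_num))
  obtain ⟨a, ha, ha', ha''⟩ := (h1.and (h2.and self_mem_nhdsWithin)).exists
  exact ⟨a, ha', ha'', ha⟩

/-- Layer-cake type bound: if `V` lies below `w l` on the layer with index `l`, then the weighted
sum of `κ` over layers is controlled by the sizes of the super-level sets. -/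
lemma tsum_mul_layer_le {α : Type*} (V : α → ℝ) (s : ℕ → ℝ) (w κ : ℕ → ℝ≥0∞) (l : α → ℕ)
    (hw : ∀ x, ENNReal.ofReal (V x) ≤ w (l x)) (hs : ∀ x, 0 < V x → s (l x) < V x) :
    ∑' x, ENNReal.ofReal (V x) * κ (l x) ≤
      ∑' n, (({x | s n < V x}.encard : ℕ∞) : ℝ≥0∞) * (w n * κ n) := by
  calc _ ≤ ∑' x, ∑' n, {x | s n < V x}.indicator 1 x * (w n * κ n) := by
        refine ENNReal.tsum_le_tsum fun x => ?_
        rcases le_or_gt (V x) 0 with h | h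
        · simp [ENNReal.ofReal_of_nonpos h]
        · refine le_trans ?_ (ENNReal.le_tsum (l x))
          simp only [Set.indicator, Set.mem_ofPred_eq, hs x h, if_true, Pi.one_apply, one_mul]
          gcongr
          exact hw x
    _ = _ := by
        rw [ENNReal.tsum_comm]
        refine tsum_congr fun n => ?_
        rw [ENNReal.tsum_mul_right, ← tsum_subtype, ← ENNReal.tsum_set_one]
        rfl

lemma enorm_add_sq_le (z w : ℂ) : ‖z + w‖ₑ ^ 2 ≤ 2 * ‖z‖ₑ ^ 2 + 2 * ‖w‖ₑ ^ 2 := by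
  have : ‖z + w‖₊ ^ 2 ≤ 2 * ‖z‖₊ ^ 2 + 2 * ‖w‖₊ ^ 2 :=
    (pow_le_pow_left₀ zero_le (nnnorm_add_le z w) 2).trans (add_sq_le.trans_eq (mul_add _ _ _))
  simp only [enorm_eq_nnnorm]
  exact_mod_cast this

lemma exists_finrank_le_of_bounded {d : ℕ} (hd : 3 ≤ d) {q : ℝ} (hq' : q < (d : ℝ) / 2) :
    ∃ (δ : ℝ) (c : ℝ≥0∞), 0 < δ ∧ c ≠ ⊤ ∧ ∀ V : (Fin d → ℤ) → ℝ, (∀ x, 0 ≤ V x) →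
      (∀ x, V x ≤ δ) → ∀ M : ℝ≥0∞,
      (∀ t : ℝ, 0 < t → ENNReal.ofReal (t ^ q) * (nuCount d V t : ℝ≥0∞) ≤ M) →
      ∀ L : Submodule ℂ ((Fin d → ℤ) → ℂ), (∀ u ∈ L, (Function.support u).Finite) →
        FiniteDimensional ℂ L → (∀ u ∈ L, u ≠ 0 → Q0 u < bV V u) →
        (Module.finrank ℂ L : ℝ≥0∞) ≤ c * M := by
  obtain ⟨K, hK, hKu⟩ := exists_enorm_cubeAvg_sq_le hd
  obtain ⟨a, ha0, ha4, haq⟩ := exists_rpow_mul_lt_one hq'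
  have hd0 : (0 : ℝ) < d := by exact_mod_cast (by omega : 0 < d)
  set δ : ℝ := (1 - 4 * a) / (4 * d ^ 2) with hδ
  have hδ0 : 0 < δ := by have : 0 < 1 - 4 * a := by linarith
                         positivity
  set ρ : ℝ := a ^ (1 - q) * (4 * (2 ^ d)⁻¹) with hρ
  set C : ℝ≥0∞ := ENNReal.ofReal (δ ^ (1 - q) * a ^ (-q)) with hC
  refine ⟨δ, 4 * (C * K * (1 - ENNReal.ofReal ρ)⁻¹), hδ0, ?_, ?_⟩
  · have : 1 - ENNReal.ofReal ρ ≠ 0 := (tsub_pos_of_lt (by simpa using haq)).ne'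
    finiteness
  intro V hV hVδ M hM L hL hfd hadm
  have hlayer (x) : ∃ n : ℕ, V x ≤ δ * a ^ n ∧ (0 < V x → δ * a ^ (n + 1) < V x) := by
    rcases (hV x).eq_or_lt with h | h
    · exact ⟨0, by rw [← h]; positivity, fun h' => absurd h h'.ne⟩
    · obtain ⟨n, h1, h2⟩ := exists_nat_pow_near_of_lt_one (div_pos h hδ0)
        ((div_le_one hδ0).2 (hVδ x)) ha0 (by linarith)
      rw [lt_div_iff₀' hδ0] at h1
      rw [div_le_iff₀' hδ0] at h2
      exact ⟨n, h2, fun _ => h1⟩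
  choose l hl1 hl2 using hlayer
  have hhigh (u : (Fin d → ℤ) → ℂ) :
      ∑' x, ENNReal.ofReal (V x) * ‖(u - cubeAvg (2 ^ l x) u) x‖ₑ ^ 2 ≤ 4⁻¹ * Q0 u := by
    calc _ ≤ ∑' x, ∑' n, ENNReal.ofReal (δ * a ^ n) * ‖(u - cubeAvg (2 ^ n) u) x‖ₑ ^ 2 := by
          refine ENNReal.tsum_le_tsum fun x => le_trans ?_ (ENNReal.le_tsum (l x))
          gcongr
          exact hl1 x
      _ = ∑' n, ENNReal.ofReal (δ * a ^ n) * l2norm (u - cubeAvg (2 ^ n) u) ^ 2 := by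
          rw [ENNReal.tsum_comm]
          simp_rw [ENNReal.tsum_mul_left, l2norm_sq]
      _ ≤ ∑' n, ENNReal.ofReal (δ * a ^ n) *
            (d * ((2 ^ n : ℕ) : ℝ≥0∞) * Q0 u ^ (1 / 2 : ℝ)) ^ 2 := by
          gcongr with n
          exact l2norm_sub_cubeAvg_le (by positivity) u
      _ = ∑' n : ℕ, ENNReal.ofReal (δ * d ^ 2) * Q0 u * ENNReal.ofReal (4 * a) ^ n := by
          refine tsum_congr fun n => ?_
          rw [mul_pow, ENNReal.rpow_half_sq, ENNReal.ofReal_mul hδ0.le,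
            ENNReal.ofReal_mul hδ0.le, ENNReal.ofReal_mul (by norm_num),
            ENNReal.ofReal_pow ha0.le, ENNReal.ofReal_pow (by positivity),
            ENNReal.ofReal_natCast, ENNReal.ofReal_ofNat]
          push_cast
          rw [mul_pow, mul_pow, ← pow_mul, mul_comm n 2, pow_mul,
            show (2 : ℝ≥0∞) ^ 2 = 4 by norm_num]
          ring
      _ = ENNReal.ofReal (δ * d ^ 2) * Q0 u * ENNReal.ofReal (1 - 4 * a)⁻¹ := by
          rw [ENNReal.tsum_mul_left, ENNReal.tsum_geometric,
            ENNReal.ofReal_inv_of_pos (by linarith), ENNReal.ofReal_sub _ (by positivity),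
            ENNReal.ofReal_one]
      _ = 4⁻¹ * Q0 u := by
          rw [mul_right_comm, ← ENNReal.ofReal_mul (by positivity)]
          have : δ * d ^ 2 * (1 - 4 * a)⁻¹ = 4⁻¹ := by
            have : 1 - 4 * a ≠ 0 := by linarith
            rw [hδ]; field_simp
          rw [this, ENNReal.ofReal_inv_of_pos (by norm_num), ENNReal.ofReal_ofNat]
  have hlow : ∑' x, ENNReal.ofReal (V x) * (K * (4 * (2 ^ d)⁻¹) ^ l x) ≤
      C * K * (1 - ENNReal.ofReal ρ)⁻¹ * M := by
    calc _ ≤ ∑' n, (nuCount d V (δ * a ^ (n + 1)) : ℝ≥0∞) *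
            (ENNReal.ofReal (δ * a ^ n) * (K * (4 * (2 ^ d)⁻¹) ^ n)) :=
          tsum_mul_layer_le V (fun n => δ * a ^ (n + 1)) (fun n => ENNReal.ofReal (δ * a ^ n))
            (fun n => K * (4 * (2 ^ d)⁻¹) ^ n) l
            (fun x => ENNReal.ofReal_le_ofReal (hl1 x)) hl2
      _ ≤ ∑' n, (M * ENNReal.ofReal ((δ * a ^ (n + 1)) ^ q)⁻¹) *
            (ENNReal.ofReal (δ * a ^ n) * (K * (4 * (2 ^ d)⁻¹) ^ n)) := by
          gcongr with n
          have hp : 0 < (δ * a ^ (n + 1)) ^ q := by positivity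
          rw [ENNReal.ofReal_inv_of_pos hp, ← div_eq_mul_inv, ENNReal.le_div_iff_mul_le
            (.inl (by simpa using hp)) (.inl ENNReal.ofReal_ne_top), mul_comm]
          exact hM _ (by positivity)
      _ = ∑' n : ℕ, (C * K * M) * ENNReal.ofReal ρ ^ n := by
          refine tsum_congr fun n => ?_
          have e1 : ((δ * a ^ (n + 1)) ^ q)⁻¹ * (δ * a ^ n) =
              δ ^ (1 - q) * a ^ (-q) * (a ^ (1 - q)) ^ n := by
            rw [← Real.rpow_neg (by positivity), Real.mul_rpow (by positivity) (by positivity),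
              pow_succ, Real.mul_rpow (by positivity) (by positivity),
              sub_eq_add_neg, Real.rpow_add hδ0, Real.rpow_add ha0, Real.rpow_one,
              Real.rpow_one, mul_pow, Real.rpow_pow_comm ha0.le]
            ring
          have e2 : ENNReal.ofReal ρ = ENNReal.ofReal (a ^ (1 - q)) * (4 * (2 ^ d)⁻¹) := by
            rw [hρ, ENNReal.ofReal_mul (by positivity), ENNReal.ofReal_mul (by positivity),
              ENNReal.ofReal_inv_of_pos (by positivity), ENNReal.ofReal_pow (by positivity)]
            simp
          have e3 := congrArg ENNReal.ofReal e1
          rw [ENNReal.ofReal_mul (by positivity), ENNReal.ofReal_mul (p := _ * _) (by positivity),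
            ENNReal.ofReal_pow (by positivity), ← hC] at e3
          rw [e2, mul_pow]
          calc _ = M * K * (4 * (2 ^ d)⁻¹) ^ n * (ENNReal.ofReal ((δ * a ^ (n + 1)) ^ q)⁻¹ *
                  ENNReal.ofReal (δ * a ^ n)) := by ring
            _ = _ := by rw [e3]; ring
      _ = _ := by rw [ENNReal.tsum_mul_left, ENNReal.tsum_geometric]; ring
  obtain ⟨u, hu1, hu2⟩ := exists_bessel_family (gradMap L hL) (gradMap_injective hd L hL)
  have hQ (i) : Q0 (u i).1 = 1 := by rw [← enorm_gradMap_sq L hL, hu1, one_pow]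
  have hone (i) : 1 ≤ 4 * ∑' x, ENNReal.ofReal (V x) *
      ‖cubeAvg (2 ^ l x) (u i).1 x‖ₑ ^ 2 := by
    set A := ∑' x, ENNReal.ofReal (V x) * ‖cubeAvg (2 ^ l x) (u i).1 x‖ₑ ^ 2
    have hne : (u i).1 ≠ 0 := by
      intro h
      have := hu1 i
      rw [Subtype.ext (a1 := u i) (a2 := 0) h, map_zero] at this
      simp at this
    have h1 : bV V (u i).1 ≤ 2 * (4⁻¹ * Q0 (u i).1) + 2 * A := by
      refine le_trans ?_ (add_le_add_left (mul_le_mul_right (hhigh (u i).1) 2) _)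
      rw [← ENNReal.tsum_mul_left, ← ENNReal.tsum_mul_left, ← ENNReal.tsum_add]
      refine ENNReal.tsum_le_tsum fun x => ?_
      rw [mul_left_comm 2, mul_left_comm 2, ← mul_add]
      refine mul_le_mul_right ?_ _
      have := enorm_add_sq_le (((u i).1 - cubeAvg (2 ^ l x) (u i).1) x)
        (cubeAvg (2 ^ l x) (u i).1 x)
      rwa [Pi.sub_apply, sub_add_cancel] at this
    have h2 := (hadm _ (u i).2 hne).le.trans h1
    rw [hQ] at h2
    have h3 : (1 : ℝ≥0∞) + 1 ≤ 1 + 4 * A := by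
      calc (1 : ℝ≥0∞) + 1 = 2 * 1 := by norm_num
        _ ≤ 2 * (2 * (4⁻¹ * 1) + 2 * A) := by gcongr
        _ = 4 * 4⁻¹ + 4 * A := by ring
        _ = _ := by rw [ENNReal.mul_inv_cancel (by norm_num) (by norm_num)]
    exact (ENNReal.add_le_add_iff_left ENNReal.one_ne_top).1 h3
  calc (Module.finrank ℂ L : ℝ≥0∞) = ∑ i : Fin (Module.finrank ℂ L), 1 := by simp
    _ ≤ ∑ i, 4 * ∑' x, ENNReal.ofReal (V x) * ‖cubeAvg (2 ^ l x) (u i).1 x‖ₑ ^ 2 :=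
        Finset.sum_le_sum fun i _ => hone i
    _ = 4 * ∑' x, ENNReal.ofReal (V x) * ∑ i, ‖cubeAvg (2 ^ l x) (u i).1 x‖ₑ ^ 2 := by
        rw [← Finset.mul_sum, ← Summable.tsum_finsetSum fun _ _ => ENNReal.summable]
        simp_rw [Finset.mul_sum]
    _ ≤ 4 * ∑' x, ENNReal.ofReal (V x) * (K * (4 * (2 ^ d)⁻¹) ^ l x) := by
        gcongr with x
        refine hu2 (cubeAvgAt (2 ^ l x) x ∘ₗ L.subtype) _ fun v => ?_
        rw [enorm_gradMap_sq]
        exact hKu v.1 (hL v.1 v.2) (l x) x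
    _ ≤ _ := by rw [mul_assoc]; gcongr

lemma exists_finrank_le {d : ℕ} (hd : 3 ≤ d) {q : ℝ} (hq' : q < (d : ℝ) / 2) :
    ∃ c : ℝ, 0 < c ∧ ∀ V : (Fin d → ℤ) → ℝ, (∀ x, 0 ≤ V x) → ∀ M : ℝ≥0∞,
      (∀ t : ℝ, 0 < t → ENNReal.ofReal (t ^ q) * (nuCount d V t : ℝ≥0∞) ≤ M) →
      ∀ L : Submodule ℂ ((Fin d → ℤ) → ℂ), (∀ u ∈ L, (Function.support u).Finite) →
        FiniteDimensional ℂ L → (∀ u ∈ L, u ≠ 0 → Q0 u < bV V u) →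
        (Module.finrank ℂ L : ℝ≥0∞) ≤ ENNReal.ofReal c * M := by
  obtain ⟨δ, c, hδ, hc, h⟩ := exists_finrank_le_of_bounded hd hq'
  have hδq : 0 < δ ^ q := by positivity
  have hcr : 0 ≤ c.toReal := ENNReal.toReal_nonneg
  refine ⟨(δ ^ q)⁻¹ + c.toReal, by positivity, ?_⟩
  intro V hV M hM L hL hfd hadm
  by_cases hMtop : M = ⊤
  · rw [hMtop, ENNReal.mul_top (by simp; positivity)]
    exact le_top
  have hν : (nuCount d V δ : ℝ≥0∞) ≤ ENNReal.ofReal (δ ^ q)⁻¹ * M := by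
    rw [ENNReal.ofReal_inv_of_pos hδq, mul_comm, ← div_eq_mul_inv, ENNReal.le_div_iff_mul_le
      (.inl (by simpa using hδq)) (.inl ENNReal.ofReal_ne_top), mul_comm]
    exact hM δ hδ
  have hfin : {x | δ < V x}.Finite := by
    rw [← Set.encard_ne_top_iff, ← ENat.toENNReal_ne_top]
    exact (hν.trans_lt (by finiteness)).ne
  have := hfin.fintype
  let res : L →ₗ[ℂ] ({x | δ < V x} → ℂ) := LinearMap.funLeft ℂ ℂ Subtype.val ∘ₗ L.subtype
  let V' : (Fin d → ℤ) → ℝ := fun x => if V x ≤ δ then V x else 0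
  let L' : Submodule ℂ ((Fin d → ℤ) → ℂ) := (LinearMap.ker res).map L.subtype
  have hL' : L' ≤ L := Submodule.map_subtype_le _ _
  have hfr : Module.finrank ℂ L' = Module.finrank ℂ (LinearMap.ker res) :=
    (Submodule.equivMapOfInjective _ L.injective_subtype _).finrank_eq.symm
  have hdim : Module.finrank ℂ L ≤ Fintype.card {x | δ < V x} + Module.finrank ℂ L' := by
    rw [hfr, ← LinearMap.finrank_range_add_finrank_ker res]
    gcongr
    exact (Submodule.finrank_le _).trans_eq (by simp)
  have hcore : (Module.finrank ℂ L' : ℝ≥0∞) ≤ c * M := by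
    refine h V' ?_ ?_ M ?_ L' (fun u hu => hL u (hL' hu))
      (Submodule.finiteDimensional_of_le hL') ?_
    · intro x; simp only [V']; split_ifs; exacts [hV x, le_rfl]
    · intro x; simp only [V']; split_ifs with hx; exacts [hx, hδ.le]
    · intro t ht
      refine le_trans ?_ (hM t ht)
      gcongr
      refine Set.encard_le_encard fun x hx => ?_
      simp only [V', Set.mem_ofPred_eq] at hx ⊢
      split_ifs at hx
      exacts [hx, hx.trans_le (hV x)]
    · intro u hu hne
      refine (hadm u (hL' hu) hne).trans_eq (tsum_congr fun x => ?_)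
      by_cases hx : V x ≤ δ
      · simp [V', hx]
      · obtain ⟨v, hv, rfl⟩ := hu
        have : v.1 x = 0 := congrFun (LinearMap.mem_ker.1 hv) ⟨x, not_le.1 hx⟩
        simp [this]
  rw [ENNReal.ofReal_add (by positivity) hcr, ENNReal.ofReal_toReal hc, add_mul]
  calc (Module.finrank ℂ L : ℝ≥0∞)
      ≤ (Fintype.card {x | δ < V x} : ℝ≥0∞) + (Module.finrank ℂ L' : ℝ≥0∞) := by
        exact_mod_cast hdim
    _ ≤ _ := by
        refine add_le_add (le_trans (le_of_eq ?_) hν) hcore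
        unfold nuCount
        rw [← hfin.cast_ncard_eq, ENat.toENNReal_coe, ← Nat.card_eq_fintype_card]
        rfl

lemma bV_div {d : ℕ} (V : (Fin d → ℤ) → ℝ) {s : ℝ} (hs : 0 < s) (u : (Fin d → ℤ) → ℂ) :
    bV V u = ENNReal.ofReal s * bV (fun x => V x / s) u := by
  unfold bV
  rw [← ENNReal.tsum_mul_left]
  refine tsum_congr fun x => ?_
  rw [← mul_assoc, ← ENNReal.ofReal_mul hs.le, mul_div_cancel₀ _ hs.ne']

lemma exists_nCount_le {d : ℕ} (hd : 3 ≤ d) {q : ℝ} (hq' : q < (d : ℝ) / 2) :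
    ∃ c : ℝ, 0 < c ∧ ∀ V : (Fin d → ℤ) → ℝ, (∀ x, 0 ≤ V x) →
      (⨆ t : {t : ℝ // 0 < t}, ENNReal.ofReal (t.1 ^ q) * (nCount d V t.1 : ℝ≥0∞)) ≤
        ENNReal.ofReal c *
          ⨆ t : {t : ℝ // 0 < t}, ENNReal.ofReal (t.1 ^ q) * (nuCount d V t.1 : ℝ≥0∞) := by
  obtain ⟨c, hc, h⟩ := exists_finrank_le hd hq'
  refine ⟨c, hc, fun V hV => ?_⟩
  set M := ⨆ t : {t : ℝ // 0 < t}, ENNReal.ofReal (t.1 ^ q) * (nuCount d V t.1 : ℝ≥0∞) with hM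
  refine iSup_le fun ⟨s, hs⟩ => ?_
  have hsq : 0 < s ^ q := by positivity
  have hs0 : ENNReal.ofReal (s ^ q) ≠ 0 := by simpa using hsq
  rw [mul_comm, ← ENNReal.le_div_iff_mul_le (.inl hs0) (.inl ENNReal.ofReal_ne_top), mul_div_assoc,
    nCount, ENat.toENNReal_iSup]
  refine iSup_le fun ⟨L, hL, hfd, hadm⟩ => ?_
  rw [ENat.toENNReal_coe]
  refine h (fun x => V x / s) (fun x => div_nonneg (hV x) hs.le) _ (fun t ht => ?_) L hL hfd
    fun u hu hne => ?_
  · have hν : nuCount d (fun x => V x / s) t = nuCount d V (t * s) := by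
      simp only [nuCount, lt_div_iff₀ hs]
    rw [ENNReal.le_div_iff_mul_le (.inl hs0) (.inl ENNReal.ofReal_ne_top), hν, mul_right_comm,
      ← ENNReal.ofReal_mul (by positivity), ← Real.mul_rpow ht.le hs.le]
    exact le_iSup (fun t : {t : ℝ // 0 < t} => ENNReal.ofReal (t.1 ^ q) *
      (nuCount d V t.1 : ℝ≥0∞)) ⟨t * s, by positivity⟩
  · have := hadm u hu hne
    rw [bV_div V hs] at this
    exact lt_of_mul_lt_mul_left' this

lemma nuCount_le_nCount {d : ℕ} (V : (Fin d → ℤ) → ℝ) {s : ℝ} (hs : 0 < s) :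
    nuCount d V (4 * d * s) ≤ nCount d V s := by
  rw [← ENat.forall_natCast_le_iff_le]
  intro n hn
  obtain ⟨A, hA, hAn⟩ := Set.exists_subset_encard_eq hn
  have hfin : A.Finite := Set.finite_of_encard_eq_coe hAn
  have := hfin.fintype
  let ext0 : (A → ℂ) →ₗ[ℂ] ((Fin d → ℤ) → ℂ) := Function.ExtendByZero.linearMap ℂ Subtype.val
  have hin (f : A → ℂ) (x : A) : ext0 f x = f x := Subtype.val_injective.extend_apply _ _ _
  have hout (f : A → ℂ) (x) (hx : x ∉ A) : ext0 f x = 0 :=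
    Function.extend_apply' _ _ _ (by simpa using hx)
  have hinj : Function.Injective ext0 := fun f g hfg => by
    ext x
    rw [← hin f, ← hin g, hfg]
  have hrank : Module.finrank ℂ (LinearMap.range ext0) = n := by
    rw [LinearMap.finrank_range_of_inj hinj, Module.finrank_fintype_fun_eq_card,
      ← Set.toFinset_card]
    rw [Set.encard_eq_coe_toFinset_card] at hAn
    exact_mod_cast hAn
  have hsupp (f : A → ℂ) : (Function.support (ext0 f)).Finite :=
    hfin.subset fun x hx => by
      by_contra hxA
      exact hx (hout f x hxA)
  refine le_of_eq_of_le (by rw [hrank]) (le_iSup (fun L : {L : Submodule ℂ ((Fin d → ℤ) → ℂ) //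
      (∀ u ∈ L, (Function.support u).Finite) ∧ FiniteDimensional ℂ L ∧
      ∀ u ∈ L, u ≠ 0 → ENNReal.ofReal s * Q0 u < bV V u} => (Module.finrank ℂ L.1 : ℕ∞))
    ⟨LinearMap.range ext0, ?_, inferInstance, ?_⟩)
  · rintro _ ⟨f, rfl⟩
    exact hsupp f
  · rintro _ ⟨f, rfl⟩ hne
    have hN : l2norm (ext0 f) < ⊤ := eLpNorm_two_count_lt_top (hsupp f)
    obtain ⟨x₀, hx₀⟩ := Function.ne_iff.1 hne
    have hx₀A : x₀ ∈ A := by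
      by_contra hxA
      exact hx₀ (hout f _ hxA)
    have hcast : ENNReal.ofReal s * (4 * d * l2norm (ext0 f) ^ 2) =
        ∑' x, ENNReal.ofReal (4 * d * s) * ‖ext0 f x‖ₑ ^ 2 := by
      rw [ENNReal.tsum_mul_left, ← l2norm_sq, ENNReal.ofReal_mul (by positivity),
        ENNReal.ofReal_mul (by positivity)]
      simp only [ENNReal.ofReal_ofNat, ENNReal.ofReal_natCast]
      ring
    refine (mul_le_mul_right (Q0_le_l2norm_sq (ext0 f)) _).trans_lt ?_
    rw [hcast]
    refine ENNReal.tsum_lt_tsum (i := x₀) ?_ (fun x => ?_) ?_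
    · rw [← hcast]; finiteness
    · by_cases hx : x ∈ A
      · refine mul_le_mul_left (ENNReal.ofReal_le_ofReal (hA hx).le) _
      · simp [hout f x hx]
    · refine ENNReal.mul_lt_mul_left (by simpa using hx₀) (by finiteness) ?_
      exact (ENNReal.ofReal_lt_ofReal_iff_of_nonneg (by positivity)).2 (hA hx₀A)

lemma ofReal_mul_iSup_nuCount_le {d : ℕ} (hd : 0 < d) (q : ℝ) (V : (Fin d → ℤ) → ℝ) :
    ENNReal.ofReal ((4 * d : ℝ) ^ (-q)) *
        (⨆ t : {t : ℝ // 0 < t}, ENNReal.ofReal (t.1 ^ q) * (nuCount d V t.1 : ℝ≥0∞)) ≤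
      ⨆ t : {t : ℝ // 0 < t}, ENNReal.ofReal (t.1 ^ q) * (nCount d V t.1 : ℝ≥0∞) := by
  have hd' : (0 : ℝ) < 4 * d := by positivity
  rw [ENNReal.mul_iSup]
  refine iSup_le fun ⟨t, ht⟩ => ?_
  refine le_trans ?_ (le_iSup _ ⟨t / (4 * d), div_pos ht hd'⟩)
  rw [← mul_assoc, ← ENNReal.ofReal_mul (by positivity), Real.div_rpow ht.le hd'.le,
    Real.rpow_neg hd'.le, inv_mul_eq_div]
  gcongr
  have := nuCount_le_nCount V (div_pos ht hd')
  rwa [mul_div_cancel₀ _ hd'.ne'] at this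

/-- for `0 < q < d/2`, two-sided comparison of
`sup_{s>0} s^q n(s,V)` with `sup_{s>0} s^q ν(s,V)`; in particular
`N₋(H_{αV}) = O(α^q)` iff `V ∈ ℓ_{q,w}(ℤ^d)`. -/
theorem two_sided_estimate (d : ℕ) (hd : 3 ≤ d) (q : ℝ) (hq : 0 < q)
    (hq' : q < (d : ℝ) / 2) :
    ∃ c₀ c₁ : ℝ, 0 < c₀ ∧ 0 < c₁ ∧
      ∀ V : (Fin d → ℤ) → ℝ, (∀ x, 0 ≤ V x) →
        (ENNReal.ofReal c₀ *
            (⨆ t : {t : ℝ // 0 < t},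
              ENNReal.ofReal (t.1 ^ q) * (nuCount d V t.1 : ℝ≥0∞)) ≤
          ⨆ t : {t : ℝ // 0 < t},
            ENNReal.ofReal (t.1 ^ q) * (nCount d V t.1 : ℝ≥0∞)) ∧
        ((⨆ t : {t : ℝ // 0 < t},
            ENNReal.ofReal (t.1 ^ q) * (nCount d V t.1 : ℝ≥0∞)) ≤
          ENNReal.ofReal c₁ *
            ⨆ t : {t : ℝ // 0 < t},
              ENNReal.ofReal (t.1 ^ q) * (nuCount d V t.1 : ℝ≥0∞)) ∧
        ((⨆ t : {t : ℝ // 0 < t},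
            ENNReal.ofReal (t.1 ^ q) * (nCount d V t.1 : ℝ≥0∞)) < ⊤ ↔
          (⨆ t : {t : ℝ // 0 < t},
            ENNReal.ofReal (t.1 ^ q) * (nuCount d V t.1 : ℝ≥0∞)) < ⊤) := by
  obtain ⟨c₁, hc₁, hup⟩ := exists_nCount_le hd hq'
  have hc₀ : (0 : ℝ) < (4 * d : ℝ) ^ (-q) := by
    have : (0 : ℝ) < d := by exact_mod_cast (by omega : 0 < d)
    positivity
  refine ⟨_, c₁, hc₀, hc₁, fun V hV => ?_⟩
  have hlow := ofReal_mul_iSup_nuCount_le (by omega : 0 < d) q V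
  refine ⟨hlow, hup V hV, fun h => ?_, fun h => ?_⟩
  · exact ENNReal.lt_top_of_mul_ne_top_right (hlow.trans_lt h).ne (by simpa using hc₀)
  · exact (hup V hV).trans_lt (ENNReal.mul_lt_top ENNReal.ofReal_lt_top h)
end
end

section
/- Let d ≥ 3 and let W : ℤ^d → [0,∞). Suppose 𝒥W is a Hardy weight on ℝ^d with constant H > 0, i.e. ∫_{ℝ^d} (𝒥W)(ξ)|U(ξ)|² dξ ≤ H · ∫_{ℝ^d} |∇U(ξ)|² dξ for every compactly supported Lipschitz function U : ℝ^d → ℂ (with ∇U its almost-everywhere gradient). Then W is a Hardy weight on ℤ^d with constant at most C·H, where C depends only on d: for every finitely supported u : ℤ^d → ℂ, Σ_{x∈ℤ^d} W(x)|u(x)|² ≤ C·H · Q_0[u]. -/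
open scoped ENNReal NNReal Topology
open Filter MeasureTheory

noncomputable section

/-- The energy of the difference of `u` and its translate by `v`. -/
def shiftEnergy {d : ℕ} (u : (Fin d → ℤ) → ℂ) (v : Fin d → ℤ) : ℝ≥0∞ :=
  ∑' x : Fin d → ℤ, ((‖u (x + v) - u x‖₊ : ℝ≥0∞)) ^ 2

lemma shiftEnergy_zero {d : ℕ} (u : (Fin d → ℤ) → ℂ) : shiftEnergy u 0 = 0 := by
  simp [shiftEnergy]

lemma shiftEnergy_neg {d : ℕ} (u : (Fin d → ℤ) → ℂ) (v : Fin d → ℤ) :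
    shiftEnergy u (-v) = shiftEnergy u v := by
  unfold shiftEnergy
  rw [← (Equiv.addRight v).tsum_eq]
  refine tsum_congr fun x => ?_
  simp only [Equiv.coe_addRight, add_neg_cancel_right]
  rw [← nnnorm_neg, neg_sub]

lemma shiftEnergy_add_le {d : ℕ} (u : (Fin d → ℤ) → ℂ) (v w : Fin d → ℤ) :
    shiftEnergy u (v + w) ≤ 2 * shiftEnergy u w + 2 * shiftEnergy u v := by
  have hshift : shiftEnergy u w =
      ∑' x : Fin d → ℤ, ((‖u (x + v + w) - u (x + v)‖₊ : ℝ≥0∞)) ^ 2 :=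
    ((Equiv.addRight v).tsum_eq
      fun x => ((‖u (x + w) - u x‖₊ : ℝ≥0∞)) ^ 2).symm
  rw [hshift]
  unfold shiftEnergy
  rw [← ENNReal.tsum_mul_left, ← ENNReal.tsum_mul_left, ← ENNReal.tsum_add]
  refine ENNReal.tsum_le_tsum fun x => ?_
  have h : ‖u (x + (v + w)) - u x‖₊ ≤
      ‖u (x + v + w) - u (x + v)‖₊ + ‖u (x + v) - u x‖₊ := by
    rw [← add_assoc, ← sub_add_sub_cancel _ (u (x + v))]
    exact nnnorm_add_le _ _
  rw [← mul_add]
  exact_mod_cast (pow_le_pow_left₀ zero_le h 2).trans add_sq_le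

lemma shiftEnergy_latUnit_le {d : ℕ} (u : (Fin d → ℤ) → ℂ) (j : Fin d) :
    shiftEnergy u (latUnit d j) ≤ Q0 u :=
  ENNReal.tsum_le_tsum fun x =>
    Finset.single_le_sum (f := fun j => ((‖u (x + latUnit d j) - u x‖₊ : ℝ≥0∞)) ^ 2)
      (fun _ _ => zero_le) (Finset.mem_univ j)

/-- The translations whose energy is dominated by the Dirichlet form. -/
def dominatedShifts (d : ℕ) : AddSubgroup (Fin d → ℤ) where
  carrier := {v | ∃ C : ℝ≥0, ∀ u : (Fin d → ℤ) → ℂ, shiftEnergy u v ≤ C * Q0 u}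
  zero_mem' := ⟨0, fun u => by simp [shiftEnergy_zero]⟩
  add_mem' := by
    rintro v w ⟨A, hA⟩ ⟨B, hB⟩
    refine ⟨2 * B + 2 * A, fun u => (shiftEnergy_add_le u v w).trans ?_⟩
    push_cast
    rw [add_mul, mul_assoc, mul_assoc]
    gcongr
    · exact hB u
    · exact hA u
  neg_mem' := by
    rintro v ⟨A, hA⟩
    exact ⟨A, fun u => (shiftEnergy_neg u v).trans_le (hA u)⟩

lemma exists_shiftEnergy_le {d : ℕ} (v : Fin d → ℤ) :
    ∃ C : ℝ≥0, ∀ u : (Fin d → ℤ) → ℂ, shiftEnergy u v ≤ C * Q0 u := by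
  have hv : v = ∑ j, v j • latUnit d j := by
    ext i
    simp [latUnit, Finset.sum_apply]
  have : v ∈ dominatedShifts d := by
    rw [hv]
    refine sum_mem fun j _ => zsmul_mem (K := dominatedShifts d) ?_ _
    exact ⟨1, fun u => by simpa using shiftEnergy_latUnit_le u j⟩
  exact this

/-- The ramp rising linearly from `0` to `1` on `[-1/2, 0]`. -/
def ramp (t : ℝ) : ℝ := max 0 (min 1 (2 * t + 1))

lemma ramp_nonneg (t : ℝ) : 0 ≤ ramp t := le_max_left _ _

lemma ramp_le_one (t : ℝ) : ramp t ≤ 1 := max_le zero_le_one (min_le_left _ _)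

lemma ramp_of_nonneg {t : ℝ} (ht : 0 ≤ t) : ramp t = 1 := by
  rw [ramp, min_eq_left (by linarith), max_eq_right zero_le_one]

lemma ramp_of_le {t : ℝ} (ht : t ≤ -(1 / 2)) : ramp t = 0 := by
  rw [ramp, max_eq_left ((min_le_right _ _).trans (by linarith))]

lemma ramp_mono : Monotone ramp := fun s t h => by
  unfold ramp
  gcongr

lemma abs_ramp_sub_le (s t : ℝ) : |ramp s - ramp t| ≤ 2 * |s - t| := by
  unfold ramp
  calc _ ≤ |min 1 (2 * s + 1) - min 1 (2 * t + 1)| := by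
        simpa using abs_max_sub_max_le_max 0 (min 1 (2 * s + 1)) 0 (min 1 (2 * t + 1))
    _ ≤ |(2 * s + 1) - (2 * t + 1)| := by
        simpa using abs_min_sub_min_le_max 1 (2 * s + 1) 1 (2 * t + 1)
    _ = 2 * |s - t| := by
        rw [← abs_two (α := ℝ), ← abs_mul, abs_two]
        ring_nf

/-- The trapezoid supported on `[-1/2, 1]` and equal to `1` on `[0, 1/2]`. -/
def trapezoid (t : ℝ) : ℝ := ramp t - ramp (t - 1)

lemma trapezoid_eq_one {t : ℝ} (h₀ : 0 ≤ t) (h₁ : t ≤ 1 / 2) : trapezoid t = 1 := by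
  rw [trapezoid, ramp_of_nonneg h₀, ramp_of_le (by linarith), sub_zero]

lemma trapezoid_of_le {t : ℝ} (ht : t ≤ -(1 / 2)) : trapezoid t = 0 := by
  rw [trapezoid, ramp_of_le ht, ramp_of_le (by linarith), sub_zero]

lemma trapezoid_of_ge {t : ℝ} (ht : 1 ≤ t) : trapezoid t = 0 := by
  rw [trapezoid, ramp_of_nonneg (by linarith), ramp_of_nonneg (by linarith), sub_self]

lemma abs_trapezoid_le_one (t : ℝ) : |trapezoid t| ≤ 1 := by
  have h := ramp_mono (sub_le_self t zero_le_one)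
  rw [trapezoid, abs_le]
  constructor <;> linarith [ramp_le_one t, ramp_nonneg (t - 1)]

lemma abs_trapezoid_sub_le (s t : ℝ) : |trapezoid s - trapezoid t| ≤ 4 * |s - t| := by
  have h₁ := abs_ramp_sub_le s t
  have h₂ := abs_ramp_sub_le (s - 1) (t - 1)
  rw [sub_sub_sub_cancel_right] at h₂
  calc |trapezoid s - trapezoid t|
      = |(ramp s - ramp t) - (ramp (s - 1) - ramp (t - 1))| := by
        unfold trapezoid
        ring_nf
    _ ≤ _ := abs_sub _ _
    _ ≤ 4 * |s - t| := by linarith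

lemma sum_trapezoid {t : ℝ} (h₁ : -1 ≤ t) (h₂ : t ≤ 2) :
    ∑ k ∈ Finset.Icc (-1 : ℤ) 2, trapezoid (t - k) = 1 := by
  have h : Finset.Icc (-1 : ℤ) 2 = {-1, 0, 1, 2} := by decide
  have e₁ : ramp (t + 1) = 1 := ramp_of_nonneg (by linarith)
  have e₂ : ramp (t - 3) = 0 := ramp_of_le (by linarith)
  rw [h]
  norm_num [trapezoid, sub_sub]
  norm_num [e₁, e₂]

lemma abs_prod_sub_prod_le {ι : Type*} (s : Finset ι) (f g : ι → ℝ)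
    (hf : ∀ i ∈ s, |f i| ≤ 1) (hg : ∀ i ∈ s, |g i| ≤ 1) :
    |∏ i ∈ s, f i - ∏ i ∈ s, g i| ≤ ∑ i ∈ s, |f i - g i| := by
  classical
  induction s using Finset.induction_on with
  | empty => simp
  | insert a s ha ih =>
    rw [Finset.prod_insert ha, Finset.prod_insert ha, Finset.sum_insert ha]
    have hprod : |∏ i ∈ s, f i| ≤ 1 := by
      rw [Finset.abs_prod]
      exact Finset.prod_le_one (fun _ _ => abs_nonneg _)
        fun i hi => hf i (Finset.mem_insert_of_mem hi)
    have ih' := ih (fun i hi => hf i (Finset.mem_insert_of_mem hi))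
      fun i hi => hg i (Finset.mem_insert_of_mem hi)
    calc |f a * ∏ i ∈ s, f i - g a * ∏ i ∈ s, g i|
        = |(f a - g a) * ∏ i ∈ s, f i + g a * (∏ i ∈ s, f i - ∏ i ∈ s, g i)| := by ring_nf
      _ ≤ |f a - g a| * |∏ i ∈ s, f i| + |g a| * |∏ i ∈ s, f i - ∏ i ∈ s, g i| := by
        rw [← abs_mul, ← abs_mul]
        exact abs_add_le _ _
      _ ≤ |f a - g a| * 1 + 1 * ∑ i ∈ s, |f i - g i| := by
        gcongr
        exact hg a (Finset.mem_insert_self a s)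
      _ = _ := by ring

/-- The tensor product of trapezoids translated to the lattice point `y`. -/
def latBump {d : ℕ} (y : Fin d → ℤ) (ξ : EuclideanSpace ℝ (Fin d)) : ℝ :=
  ∏ i, trapezoid (ξ i - y i)

lemma abs_latBump_sub_le {d : ℕ} (y : Fin d → ℤ) (ξ η : EuclideanSpace ℝ (Fin d)) :
    |latBump y η - latBump y ξ| ≤ 4 * d * ‖η - ξ‖ := by
  refine (abs_prod_sub_prod_le _ _ _ (fun _ _ => abs_trapezoid_le_one _)
    fun _ _ => abs_trapezoid_le_one _).trans ?_
  calc _ ≤ ∑ _i : Fin d, 4 * ‖η - ξ‖ := by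
        refine Finset.sum_le_sum fun i _ => (abs_trapezoid_sub_le _ _).trans ?_
        rw [sub_sub_sub_cancel_right]
        gcongr
        exact PiLp.norm_apply_le (η - ξ) i
    _ = _ := by
        simp
        ring

/-- The integer offsets with all coordinates in `{-1, 0, 1, 2}`. -/
def offsets (d : ℕ) : Finset (Fin d → ℤ) := Fintype.piFinset fun _ => Finset.Icc (-1) 2

lemma sum_latBump {d : ℕ} {x : Fin d → ℤ} {ξ : EuclideanSpace ℝ (Fin d)}
    (h : ∀ i, (x i : ℝ) - 1 ≤ ξ i ∧ ξ i ≤ x i + 2) :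
    ∑ v ∈ offsets d, latBump (x + v) ξ = 1 := by
  unfold offsets latBump
  simp only [Pi.add_apply, Int.cast_add, ← sub_sub]
  rw [← Finset.prod_univ_sum (fun _ => Finset.Icc (-1 : ℤ) 2)
    fun i k => trapezoid (ξ i - x i - k)]
  exact Finset.prod_eq_one fun i _ =>
    sum_trapezoid (by linarith [(h i).1]) (by linarith [(h i).2])

lemma latBump_eq_zero {d : ℕ} {x v : Fin d → ℤ} {ξ : EuclideanSpace ℝ (Fin d)}
    (h : ∀ i, (x i : ℝ) - 1 ≤ ξ i ∧ ξ i ≤ x i + 2) (hv : v ∉ offsets d) :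
    latBump (x + v) ξ = 0 := by
  simp only [offsets, Fintype.mem_piFinset, Finset.mem_Icc, not_forall] at hv
  obtain ⟨i, hi⟩ := hv
  refine Finset.prod_eq_zero (Finset.mem_univ i) ?_
  simp only [Pi.add_apply, Int.cast_add]
  by_cases h1 : -1 ≤ v i
  · have : (3 : ℝ) ≤ v i := by exact_mod_cast (by omega : (3 : ℤ) ≤ v i)
    exact trapezoid_of_le (by linarith [(h i).2])
  · have : (v i : ℝ) ≤ -2 := by exact_mod_cast (by omega : v i ≤ (-2 : ℤ))
    exact trapezoid_of_ge (by linarith [(h i).1])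

/-- The box `∏ [x_i, x_i + a)`. -/
def latBox {d : ℕ} (a : ℝ) (x : Fin d → ℤ) : Set (EuclideanSpace ℝ (Fin d)) :=
  {ξ | ∀ i, ξ i ∈ Set.Ico (x i : ℝ) (x i + a)}

lemma latBox_eq_preimage {d : ℕ} (a : ℝ) (x : Fin d → ℤ) :
    latBox a x = (WithLp.ofLp : EuclideanSpace ℝ (Fin d) → Fin d → ℝ) ⁻¹'
      Set.univ.pi fun i => Set.Ico (x i : ℝ) (x i + a) := by
  ext ξ
  simp [latBox]

lemma measurableSet_latBox {d : ℕ} (a : ℝ) (x : Fin d → ℤ) : MeasurableSet (latBox a x) := by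
  rw [latBox_eq_preimage]
  exact (PiLp.volume_preserving_ofLp (Fin d)).measurable
    (MeasurableSet.univ_pi fun _ => measurableSet_Ico)

lemma volume_latBox {d : ℕ} (a : ℝ) (x : Fin d → ℤ) :
    volume (latBox a x) = ENNReal.ofReal a ^ d := by
  rw [latBox_eq_preimage, (PiLp.volume_preserving_ofLp (Fin d)).measure_preimage
    (MeasurableSet.univ_pi fun _ => measurableSet_Ico).nullMeasurableSet, Real.volume_pi_Ico]
  simp

lemma floor_eq_of_mem_latBox {d : ℕ} {a : ℝ} (ha : a ≤ 1) {x : Fin d → ℤ}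
    {ξ : EuclideanSpace ℝ (Fin d)} (h : ξ ∈ latBox a x) : (fun i => ⌊ξ i⌋) = x :=
  funext fun i => Int.floor_eq_iff.2 ⟨(h i).1, (h i).2.trans_le (by linarith)⟩

lemma pairwise_disjoint_latBox {d : ℕ} {a : ℝ} (ha : a ≤ 1) :
    Pairwise (Function.onFun Disjoint (latBox (d := d) a)) := fun _ _ hxy =>
  Set.disjoint_left.2 fun _ h₁ h₂ =>
    hxy ((floor_eq_of_mem_latBox ha h₁).symm.trans (floor_eq_of_mem_latBox ha h₂))

lemma iUnion_latBox_one (d : ℕ) : ⋃ x, latBox (d := d) 1 x = Set.univ :=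
  Set.eq_univ_of_forall fun ξ => Set.mem_iUnion.2
    ⟨fun i => ⌊ξ i⌋, fun _ => ⟨Int.floor_le _, Int.lt_floor_add_one _⟩⟩

lemma latBump_self {d : ℕ} {x : Fin d → ℤ} {ξ : EuclideanSpace ℝ (Fin d)}
    (h : ξ ∈ latBox (1 / 2) x) : latBump x ξ = 1 :=
  Finset.prod_eq_one fun i _ =>
    trapezoid_eq_one (by linarith [(h i).1]) (by linarith [(h i).2])

lemma latBump_of_ne {d : ℕ} {x y : Fin d → ℤ} {ξ : EuclideanSpace ℝ (Fin d)}
    (h : ξ ∈ latBox (1 / 2) x) (hxy : y ≠ x) : latBump y ξ = 0 := by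
  obtain ⟨i, hi⟩ := Function.ne_iff.1 hxy
  refine Finset.prod_eq_zero (Finset.mem_univ i) ?_
  rcases lt_or_gt_of_ne hi with hlt | hgt
  · have : (y i : ℝ) + 1 ≤ x i := by exact_mod_cast hlt
    exact trapezoid_of_ge (by linarith [(h i).1])
  · have : (x i : ℝ) + 1 ≤ y i := by exact_mod_cast hgt
    exact trapezoid_of_le (by linarith [(h i).2])

/-- The Lipschitz interpolation of a lattice function by tensor products of trapezoids. -/
def latInterp {d : ℕ} (u : (Fin d → ℤ) → ℂ) (ξ : EuclideanSpace ℝ (Fin d)) : ℂ :=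
  ∑' y, u y * (latBump y ξ : ℂ)

lemma latInterp_eq_sum_support {d : ℕ} {u : (Fin d → ℤ) → ℂ} (hu : (Function.support u).Finite)
    (ξ : EuclideanSpace ℝ (Fin d)) :
    latInterp u ξ = ∑ y ∈ hu.toFinset, u y * (latBump y ξ : ℂ) :=
  tsum_eq_sum fun y hy => by
    have : u y = 0 := by simpa using hy
    rw [this, zero_mul]

lemma latInterp_of_mem_latBox {d : ℕ} (u : (Fin d → ℤ) → ℂ) {x : Fin d → ℤ}
    {ξ : EuclideanSpace ℝ (Fin d)} (h : ξ ∈ latBox (1 / 2) x) : latInterp u ξ = u x := by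
  rw [latInterp, tsum_eq_single x fun y hy => by rw [latBump_of_ne h hy]; simp,
    latBump_self h]
  simp

lemma latInterp_sub_eq {d : ℕ} (u : (Fin d → ℤ) → ℂ) {x : Fin d → ℤ}
    {ξ : EuclideanSpace ℝ (Fin d)} (h : ∀ i, (x i : ℝ) - 1 ≤ ξ i ∧ ξ i ≤ x i + 2) :
    latInterp u ξ - u x = ∑ v ∈ offsets d, (u (x + v) - u x) * (latBump (x + v) ξ : ℂ) := by
  have hsum : latInterp u ξ = ∑ v ∈ offsets d, u (x + v) * (latBump (x + v) ξ : ℂ) := by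
    rw [latInterp, ← (Equiv.addLeft x).tsum_eq]
    refine tsum_eq_sum fun v hv => ?_
    simp [latBump_eq_zero h hv]
  simp only [sub_mul, Finset.sum_sub_distrib, ← Finset.mul_sum, hsum]
  rw [← Complex.ofReal_sum, sum_latBump h]
  simp

lemma lipschitzWith_latInterp {d : ℕ} {u : (Fin d → ℤ) → ℂ} (hu : (Function.support u).Finite) :
    LipschitzWith (∑ y ∈ hu.toFinset, ‖u y‖₊ * (4 * d)) (latInterp u) := by
  refine LipschitzWith.of_dist_le_mul fun η ξ => ?_
  rw [dist_eq_norm, dist_eq_norm, latInterp_eq_sum_support hu, latInterp_eq_sum_support hu,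
    ← Finset.sum_sub_distrib]
  push_cast
  rw [Finset.sum_mul]
  refine norm_sum_le_of_le _ fun y _ => ?_
  rw [← mul_sub, norm_mul, ← Complex.ofReal_sub, Complex.norm_real, mul_assoc]
  exact mul_le_mul_of_nonneg_left (abs_latBump_sub_le y ξ η) (norm_nonneg _)

lemma latBump_eq_zero_of_dist {d : ℕ} {y : Fin d → ℤ} {ξ : EuclideanSpace ℝ (Fin d)}
    (h : √d < dist ξ (WithLp.toLp 2 fun i => (y i : ℝ))) : latBump y ξ = 0 := by
  by_contra hne
  refine h.not_ge ?_
  rw [EuclideanSpace.dist_eq]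
  refine Real.sqrt_le_sqrt ?_
  calc _ ≤ ∑ _i : Fin d, (1 : ℝ) := by
        refine Finset.sum_le_sum fun i _ => ?_
        have hi : trapezoid (ξ i - y i) ≠ 0 := fun h0 =>
          hne (Finset.prod_eq_zero (Finset.mem_univ i) h0)
        rw [Real.dist_eq, sq_le_one_iff_abs_le_one, abs_abs, abs_le]
        constructor
        · by_contra! hlt
          exact hi (trapezoid_of_le (by linarith))
        · by_contra! hlt
          exact hi (trapezoid_of_ge hlt.le)
    _ = d := by simp

lemma hasCompactSupport_latInterp {d : ℕ} {u : (Fin d → ℤ) → ℂ}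
    (hu : (Function.support u).Finite) : HasCompactSupport (latInterp u) := by
  refine HasCompactSupport.intro (hu.toFinset.isCompact_biUnion fun y _ =>
    isCompact_closedBall (WithLp.toLp 2 fun i => (y i : ℝ)) (√d)) fun ξ hξ => ?_
  rw [latInterp_eq_sum_support hu]
  refine Finset.sum_eq_zero fun y hy => ?_
  have : latBump y ξ = 0 := latBump_eq_zero_of_dist <| by
    by_contra! hle
    exact hξ (Set.mem_biUnion hy hle)
  simp [this]

lemma norm_fderiv_latInterp_le {d : ℕ} (u : (Fin d → ℤ) → ℂ) {x : Fin d → ℤ}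
    {ξ : EuclideanSpace ℝ (Fin d)} (h : ξ ∈ latBox 1 x) :
    ‖fderiv ℝ (latInterp u) ξ‖ ≤ 4 * d * ∑ v ∈ offsets d, ‖u (x + v) - u x‖ := by
  refine norm_fderiv_le_of_lip' ℝ (by positivity) ?_
  filter_upwards [Metric.ball_mem_nhds ξ one_pos] with η hη
  have hη' : ∀ i, (x i : ℝ) - 1 ≤ η i ∧ η i ≤ x i + 2 := fun i => by
    have h₁ : |η i - ξ i| < 1 :=
      (PiLp.norm_apply_le (η - ξ) i).trans_lt (by simpa [dist_eq_norm] using hη)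
    rw [abs_lt] at h₁
    constructor <;> linarith [(h i).1, (h i).2]
  have hξ' : ∀ i, (x i : ℝ) - 1 ≤ ξ i ∧ ξ i ≤ x i + 2 := fun i => by
    constructor <;> linarith [(h i).1, (h i).2]
  rw [← sub_sub_sub_cancel_right _ _ (u x), latInterp_sub_eq u hη', latInterp_sub_eq u hξ',
    ← Finset.sum_sub_distrib, mul_right_comm, Finset.mul_sum]
  refine norm_sum_le_of_le _ fun v _ => ?_
  rw [← mul_sub, norm_mul, ← Complex.ofReal_sub, Complex.norm_real, mul_comm]
  exact mul_le_mul_of_nonneg_right (abs_latBump_sub_le _ ξ η) (norm_nonneg _)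

lemma nnnorm_fderiv_latInterp_sq_le {d : ℕ} (u : (Fin d → ℤ) → ℂ) {x : Fin d → ℤ}
    {ξ : EuclideanSpace ℝ (Fin d)} (h : ξ ∈ latBox 1 x) :
    ((‖fderiv ℝ (latInterp u) ξ‖₊ : ℝ≥0∞)) ^ 2 ≤
      ((4 * d) ^ 2 * (offsets d).card : ℝ≥0) *
        ∑ v ∈ offsets d, ((‖u (x + v) - u x‖₊ : ℝ≥0∞)) ^ 2 := by
  have h₁ : ‖fderiv ℝ (latInterp u) ξ‖₊ ≤ 4 * d * ∑ v ∈ offsets d, ‖u (x + v) - u x‖₊ := by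
    have := norm_fderiv_latInterp_le u h
    rw [← NNReal.coe_le_coe]
    push_cast
    exact this
  have h₂ : ‖fderiv ℝ (latInterp u) ξ‖₊ ^ 2 ≤ (4 * d) ^ 2 * (offsets d).card *
      ∑ v ∈ offsets d, ‖u (x + v) - u x‖₊ ^ 2 := by
    refine (pow_le_pow_left₀ zero_le h₁ 2).trans ?_
    rw [mul_pow, mul_assoc]
    gcongr
    exact sq_sum_le_card_mul_sum_sq
  exact_mod_cast h₂

lemma lintegral_fderiv_latInterp_le {d : ℕ} (u : (Fin d → ℤ) → ℂ) :
    ∫⁻ ξ : EuclideanSpace ℝ (Fin d), ((‖fderiv ℝ (latInterp u) ξ‖₊ : ℝ≥0∞)) ^ 2 ≤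
      ((4 * d) ^ 2 * (offsets d).card : ℝ≥0) * ∑ v ∈ offsets d, shiftEnergy u v := by
  rw [← setLIntegral_univ, ← iUnion_latBox_one, lintegral_iUnion (measurableSet_latBox 1)
    (pairwise_disjoint_latBox le_rfl)]
  unfold shiftEnergy
  rw [← Summable.tsum_finsetSum fun _ _ => ENNReal.summable, ← ENNReal.tsum_mul_left]
  refine ENNReal.tsum_le_tsum fun x => ?_
  refine (setLIntegral_mono' (measurableSet_latBox 1 x) fun ξ hξ =>
    nnnorm_fderiv_latInterp_sq_le u hξ).trans ?_
  rw [setLIntegral_const, volume_latBox]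
  simp

lemma bV_le_lintegral_latInterp {d : ℕ} (W : (Fin d → ℤ) → ℝ) (u : (Fin d → ℤ) → ℂ) :
    bV W u ≤ 2 ^ d * ∫⁻ ξ : EuclideanSpace ℝ (Fin d),
      ENNReal.ofReal (W fun i => ⌊ξ i⌋) * ((‖latInterp u ξ‖₊ : ℝ≥0∞)) ^ 2 := by
  have ha : (1 / 2 : ℝ) ≤ 1 := by norm_num
  have hvol : (2 : ℝ≥0∞) ^ d * ENNReal.ofReal (1 / 2) ^ d = 1 := by
    rw [← mul_pow, ← ENNReal.ofReal_ofNat, ← ENNReal.ofReal_mul (by norm_num)]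
    norm_num
  calc bV W u = 2 ^ d * ∑' x, ∫⁻ ξ in latBox (1 / 2) x,
        ENNReal.ofReal (W fun i => ⌊ξ i⌋) * ((‖latInterp u ξ‖₊ : ℝ≥0∞)) ^ 2 := by
        rw [bV, ← ENNReal.tsum_mul_left]
        refine tsum_congr fun x => ?_
        rw [setLIntegral_congr_fun (g := fun _ => ENNReal.ofReal (W x) * (‖u x‖₊ : ℝ≥0∞) ^ 2)
          (measurableSet_latBox _ x) fun ξ hξ => by
            simp only [floor_eq_of_mem_latBox ha hξ, latInterp_of_mem_latBox u hξ],
          setLIntegral_const, volume_latBox, mul_left_comm, hvol, mul_one]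
    _ ≤ _ := by
        rw [← lintegral_iUnion (measurableSet_latBox _) (pairwise_disjoint_latBox ha)]
        gcongr
        exact Measure.restrict_le_self

/-- if the step weight `𝒥W` is a Hardy weight on `ℝ^d` with constant `H`
(tested on compactly supported Lipschitz functions, with the a.e. gradient), then `W`
is a discrete Hardy weight on `ℤ^d` with constant at most `C·H`, `C = C(d)`. -/
theorem discrete_hardy_from_continuous (d : ℕ) (hd : 3 ≤ d) :
    ∃ C : ℝ, 0 < C ∧
      ∀ W : (Fin d → ℤ) → ℝ, (∀ x, 0 ≤ W x) →
      ∀ H : ℝ, 0 < H →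
      (∀ U : EuclideanSpace ℝ (Fin d) → ℂ,
        (∃ K : ℝ≥0, LipschitzWith K U) → HasCompactSupport U →
        (∫⁻ ξ : EuclideanSpace ℝ (Fin d),
            ENNReal.ofReal (W fun i => ⌊ξ i⌋) * ((‖U ξ‖₊ : ℝ≥0∞)) ^ 2) ≤
          ENNReal.ofReal H *
            ∫⁻ ξ : EuclideanSpace ℝ (Fin d), ((‖fderiv ℝ U ξ‖₊ : ℝ≥0∞)) ^ 2) →
      ∀ u : (Fin d → ℤ) → ℂ, (Function.support u).Finite →
        bV W u ≤ ENNReal.ofReal (C * H) * Q0 u := by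
  choose A hA using fun v : Fin d → ℤ => exists_shiftEnergy_le v
  set B : ℝ≥0 := 2 ^ d * ((4 * d) ^ 2 * (offsets d).card * ∑ v ∈ offsets d, A v) with hB
  refine ⟨B + 1, by positivity, fun W _ H hH hardy u hu => ?_⟩
  calc bV W u ≤ 2 ^ d * (ENNReal.ofReal H * (((4 * d) ^ 2 * (offsets d).card : ℝ≥0) *
        ∑ v ∈ offsets d, A v * Q0 u)) := by
        refine (bV_le_lintegral_latInterp W u).trans ?_
        gcongr
        refine (hardy _ ⟨_, lipschitzWith_latInterp hu⟩ (hasCompactSupport_latInterp hu)).trans ?_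
        gcongr
        refine (lintegral_fderiv_latInterp_le u).trans ?_
        gcongr with v
        exact hA v u
    _ = B * ENNReal.ofReal H * Q0 u := by
        rw [← Finset.sum_mul, hB]
        push_cast
        ring
    _ ≤ ENNReal.ofReal ((B + 1) * H) * Q0 u := by
        rw [ENNReal.ofReal_mul (by positivity)]
        gcongr
        rw [← ENNReal.ofReal_coe_nnreal]
        exact ENNReal.ofReal_le_ofReal (by linarith)
end
end

section
/- Let d ≥ 3. There exists a constant C = C(d) such that every W : ℤ^d → [0,∞) with A := sup_{s>0} s · (card{x ∈ ℤ^d : W(x) > s})^{2/d} < ∞ (all these sets being finite) is a Hardy weight on ℤ^d with constant at most C·A: for every finitely supported u : ℤ^d → ℂ, Σ_{x∈ℤ^d} W(x)|u(x)|² ≤ C·A · Q_0[u]. -/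
open scoped ENNReal NNReal Topology
open Filter MeasureTheory

noncomputable section

theorem Measure.pi_count_eq_count {ι : Type*} [Fintype ι] {A : ι → Type*}
    [∀ i, MeasurableSpace (A i)] [∀ i, MeasurableSingletonClass (A i)] [∀ i, Countable (A i)] :
    Measure.pi (fun i => (Measure.count : Measure (A i))) = Measure.count := by
  refine Measure.ext_of_singleton fun a => ?_
  rw [Measure.pi_singleton, Measure.count_singleton]
  simp

/-- The discrete grid-lines lemma. -/
theorem tsum_prod_tsum_update_rpow_le {ι : Type*} [Fintype ι] [DecidableEq ι] {p : ℝ}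
    (hp : Real.HolderConjugate (Fintype.card ι) p) (f : (ι → ℤ) → ℝ≥0∞) :
    ∑' x, ∏ i, (∑' t : ℤ, f (Function.update x i t)) ^ ((1 : ℝ) / (Fintype.card ι - 1)) ≤
      (∑' x, f x) ^ p := by
  have h := lintegral_prod_lintegral_pow_le (fun _ : ι => (Measure.count : Measure ℤ)) hp
    (measurable_of_countable f)
  simpa only [Measure.pi_count_eq_count, lintegral_count] using h

/-- A function of finite support on `ℤ` is bounded by its total variation. -/
theorem edist_zero_le_tsum_edist {E : Type*} [PseudoEMetricSpace E] [Zero E] {g : ℤ → E}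
    (hg : (Function.support g).Finite) (a : ℤ) :
    edist (g a) 0 ≤ ∑' t : ℤ, edist (g (t + 1)) (g t) := by
  obtain ⟨b, hb⟩ := hg.bddAbove
  have hn : g (a + ((b + 1 - a).toNat : ℕ)) = 0 := by
    by_contra h
    have := hb h
    omega
  have h1 := edist_le_range_sum_edist (fun n : ℕ => g (a + n)) (b + 1 - a).toNat
  simp only [hn, Nat.cast_zero, add_zero] at h1
  refine h1.trans ((ENNReal.sum_le_tsum _).trans ?_)
  have hinj : Function.Injective (fun n : ℕ => a + (n : ℤ)) := fun m n h => by
    simpa using h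
  refine le_trans (le_of_eq ?_) (ENNReal.tsum_comp_le_tsum_of_injective hinj _)
  refine tsum_congr fun n => ?_
  rw [edist_comm]
  push_cast
  rw [add_assoc]

theorem update_add_latUnit {d : ℕ} (x : Fin d → ℤ) (i : Fin d) (t : ℤ) :
    Function.update x i t + latUnit d i = Function.update x i (t + 1) := by
  ext k
  by_cases h : k = i
  · subst h; simp [latUnit]
  · simp [latUnit, h]

/-- The isoperimetric inequality on `ℤ^d` in functional form. -/
theorem mul_card_rpow_le_tsum_edist {d : ℕ} (hd : 2 ≤ d) {E : Type*} [PseudoEMetricSpace E]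
    [Zero E] {f : (Fin d → ℤ) → E} (hf : (Function.support f).Finite) (K : Finset (Fin d → ℤ))
    (c : ℝ≥0∞) (hc : ∀ x ∈ K, c ≤ edist (f x) 0) :
    c * (K.card : ℝ≥0∞) ^ (1 - (1 : ℝ) / d) ≤
      ∑' x, ∑ j, edist (f (x + latUnit d j)) (f x) := by
  have hd' : (2 : ℝ) ≤ d := by exact_mod_cast hd
  set F : (Fin d → ℤ) → ℝ≥0∞ := fun x => ∑ j, edist (f (x + latUnit d j)) (f x)
  set p : ℝ := d / (d - 1)
  have hp : Real.HolderConjugate (Fintype.card (Fin d)) p := by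
    rw [Fintype.card_fin]
    exact Real.HolderConjugate.conjExponent (by linarith)
  have hp0 : 0 < p := hp.symm.pos
  have hgrid := tsum_prod_tsum_update_rpow_le hp F
  rw [Fintype.card_fin] at hgrid
  have hline : ∀ x ∈ K, ∀ i, c ≤ ∑' t : ℤ, F (Function.update x i t) := by
    intro x hx i
    have hs : (Function.support fun t : ℤ => f (Function.update x i t)).Finite :=
      hf.preimage (f := fun t : ℤ => Function.update x i t)
        (Function.update_injective x i).injOn
    have h := edist_zero_le_tsum_edist hs (x i)
    rw [Function.update_eq_self] at h
    refine (hc x hx).trans (h.trans (ENNReal.tsum_le_tsum fun t => ?_))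
    rw [← update_add_latUnit]
    exact Finset.single_le_sum
      (f := fun j => edist (f (Function.update x i t + latUnit d j)) (f (Function.update x i t)))
      (fun _ _ => zero_le) (Finset.mem_univ i)
  have hsum : (K.card : ℝ≥0∞) * c ^ p ≤ (∑' x, F x) ^ p := by
    refine le_trans ?_ hgrid
    refine le_trans ?_ (ENNReal.sum_le_tsum K)
    rw [← nsmul_eq_mul]
    refine Finset.card_nsmul_le_sum _ _ _ fun x hx => ?_
    calc c ^ p = ∏ _i : Fin d, c ^ ((1 : ℝ) / (d - 1)) := by
          rw [Finset.prod_const, Finset.card_univ, Fintype.card_fin, ← ENNReal.rpow_natCast,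
            ← ENNReal.rpow_mul]
          congr 1
          simp only [p]
          ring
      _ ≤ _ := Finset.prod_le_prod' fun i _ =>
          ENNReal.rpow_le_rpow (hline x hx i) (one_div_nonneg.2 (by linarith))
  have h := ENNReal.rpow_le_rpow hsum (inv_nonneg.2 hp0.le)
  rw [ENNReal.mul_rpow_of_nonneg _ _ (inv_nonneg.2 hp0.le), ← ENNReal.rpow_mul,
    ← ENNReal.rpow_mul, mul_inv_cancel₀ hp0.ne', ENNReal.rpow_one, ENNReal.rpow_one,
    mul_comm] at h
  convert! h using 3
  simp only [p]
  field_simp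

/-- Cauchy–Schwarz for a gradient supported near `K`. -/
theorem sq_tsum_edist_le {d : ℕ} {f : (Fin d → ℤ) → ℝ} (K : Finset (Fin d → ℤ))
    (hf : ∀ x, x ∉ K → f x = 0) :
    (∑' x, ∑ j, edist (f (x + latUnit d j)) (f x)) ^ 2 ≤
      2 * d * K.card * ∑' x, ∑ j, edist (f (x + latUnit d j)) (f x) ^ 2 := by
  classical
  set P : Finset ((Fin d → ℤ) × Fin d) :=
    K ×ˢ Finset.univ ∪ (K ×ˢ Finset.univ).image fun y => (y.1 - latUnit d y.2, y.2)
  have hP : (P.card : ℝ≥0∞) ≤ 2 * d * K.card := by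
    have h : P.card ≤ 2 * d * K.card := by
      refine (Finset.card_union_le _ _).trans
        ((Nat.add_le_add_left Finset.card_image_le _).trans (le_of_eq ?_))
      rw [Finset.card_product, Finset.card_univ, Fintype.card_fin]
      ring
    exact_mod_cast h
  have hzero : ∀ y : (Fin d → ℤ) × Fin d, y ∉ P →
      nndist (f (y.1 + latUnit d y.2)) (f y.1) = 0 := by
    intro y hy
    have h1 : y.1 ∉ K := fun h => hy (Finset.mem_union_left _ (by simp [h]))
    have h2 : y.1 + latUnit d y.2 ∉ K := fun h => hy (Finset.mem_union_right _
      (Finset.mem_image.2 ⟨(y.1 + latUnit d y.2, y.2), by simp [h], by simp⟩))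
    rw [hf _ h1, hf _ h2, nndist_self]
  have key : ∀ n : ℕ, n ≠ 0 → ∑' x, ∑ j, edist (f (x + latUnit d j)) (f x) ^ n =
      ((∑ y ∈ P, nndist (f (y.1 + latUnit d y.2)) (f y.1) ^ n : ℝ≥0) : ℝ≥0∞) := by
    intro n hn
    simp_rw [← tsum_fintype (L := .unconditional _)]
    rw [← ENNReal.tsum_prod
      (f := fun (x : Fin d → ℤ) (j : Fin d) => edist (f (x + latUnit d j)) (f x) ^ n),
      tsum_eq_sum (s := P)]
    · push_cast
      rfl
    · intro y hy
      rw [edist_nndist, hzero y hy]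
      simp [hn]
  have k1 := key 1 one_ne_zero
  simp only [pow_one] at k1
  rw [k1, key 2 two_ne_zero]
  refine le_trans ?_ (mul_le_mul_left hP _)
  exact_mod_cast sq_sum_le_card_mul_sum_sq (s := P)
    (f := fun y => nndist (f (y.1 + latUnit d y.2)) (f y.1))

/-- The truncations of a function at successive levels have total energy at most its own. -/
theorem tsum_edist_truncation_sq_le {t : ℕ → ℝ} (ht : Antitone t) (a b : ℝ) :
    ∑' k, edist (min a (t k) - min a (t (k + 1))) (min b (t k) - min b (t (k + 1))) ^ 2 ≤
      edist a b ^ 2 := by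
  wlog h : b ≤ a generalizing a b
  · have := this b a (le_of_not_ge h)
    rw [edist_comm b a] at this
    simpa only [edist_comm] using this
  have hk : ∀ k, 0 ≤ min a (t k) - min a (t (k + 1)) - (min b (t k) - min b (t (k + 1))) := by
    intro k
    have := ht (Nat.le_add_right k 1)
    simp only [min_def]
    split_ifs <;> linarith
  refine ENNReal.tsum_le_of_sum_range_le fun n => ?_
  simp_rw [edist_dist, Real.dist_eq, ← ENNReal.ofReal_pow (abs_nonneg _)]
  rw [← ENNReal.ofReal_sum_of_nonneg fun _ _ => by positivity]
  refine ENNReal.ofReal_le_ofReal ?_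
  simp_rw [sq_abs]
  refine (Finset.sum_sq_le_sq_sum_of_nonneg fun k _ => hk k).trans ?_
  refine pow_le_pow_left₀ (Finset.sum_nonneg fun k _ => hk k) ?_ 2
  have htel : ∀ c : ℝ, ∑ k ∈ Finset.range n, (min c (t k) - min c (t (k + 1))) =
      min c (t 0) - min c (t n) := fun c => Finset.sum_range_sub' (fun k => min c (t k)) n
  rw [Finset.sum_sub_distrib, htel, htel]
  have := ht (Nat.zero_le n)
  simp only [min_def]
  split_ifs <;> linarith

/-- A weight in the weak class sums over a finite set like the extremal profile. -/
theorem sum_le_of_weak_class {α : Type*} {W : α → ℝ} {p A : ℝ} (hp0 : 0 ≤ p) (hp : p ≤ 2 / 3)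
    (hfin : ∀ s : ℝ, 0 < s → {x | s < W x}.Finite)
    (hA : ∀ s : ℝ, 0 < s → s * ({x | s < W x}.ncard : ℝ) ^ p ≤ A) (K : Finset α) :
    ∑ x ∈ K, W x ≤ 3 * A * (K.card : ℝ) ^ (1 - p) := by
  classical
  have hA0 : 0 ≤ A := le_trans (by positivity) (hA 1 one_pos)
  induction h : K.card generalizing K with
  | zero =>
    rw [Finset.card_eq_zero.1 h]
    simp only [Finset.sum_empty]
    positivity
  | succ n ih =>
    obtain ⟨x, hx, hmin⟩ := K.exists_min_image W (Finset.card_pos.1 (by omega))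
    rw [← Finset.add_sum_erase K W hx]
    have h1 := ih (K.erase x) (by rw [Finset.card_erase_of_mem hx, h]; rfl)
    set N : ℝ := ((n + 1 : ℕ) : ℝ)
    have hN : 0 < N := by positivity
    have h2 : W x ≤ A * N ^ (-p) := by
      rw [Real.rpow_neg hN.le, ← div_eq_mul_inv]
      by_contra! hlt
      obtain ⟨s, hs1, hs2⟩ := exists_between hlt
      have hs0 : 0 < s := lt_of_le_of_lt (by positivity) hs1
      have hsub : (K : Set α) ⊆ {y | s < W y} := fun y hy => hs2.trans_le (hmin y hy)
      have hcard := Set.ncard_le_ncard hsub (hfin s hs0)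
      rw [Set.ncard_coe_finset, h] at hcard
      have hle : s * N ^ p ≤ A := le_trans (by simp only [N]; gcongr) (hA s hs0)
      exact absurd ((div_lt_iff₀ (by positivity)).1 hs1) hle.not_gt
    have h3 : N ^ (-p) ≤ 3 * (N ^ (1 - p) - (n : ℝ) ^ (1 - p)) := by
      have hb := rpow_one_add_le_one_add_mul_self (s := -N⁻¹) (p := 1 - p)
        (neg_le_neg (inv_le_one_of_one_le₀ (by simp [N]))) (by linarith) (by linarith)
      have hn : (n : ℝ) = N * (1 + -N⁻¹) := by
        field_simp
        simp [N]
      have hinv : 0 ≤ 1 + -N⁻¹ := by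
        have : N⁻¹ ≤ 1 := inv_le_one_of_one_le₀ (by simp [N])
        linarith
      have hNp : N ^ (1 - p) * N⁻¹ = N ^ (-p) := by
        rw [← Real.rpow_neg_one, ← Real.rpow_add hN]
        congr 1
        ring
      have hle := mul_le_mul_of_nonneg_left hb (Real.rpow_nonneg hN.le (1 - p))
      rw [← Real.mul_rpow hN.le hinv, ← hn] at hle
      have hpos := Real.rpow_nonneg hN.le (-p)
      nlinarith [mul_nonneg hpos (sub_nonneg.2 hp)]
    calc W x + ∑ y ∈ K.erase x, W y ≤ A * N ^ (-p) + 3 * A * (n : ℝ) ^ (1 - p) := add_le_add h2 h1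
      _ ≤ A * (3 * (N ^ (1 - p) - (n : ℝ) ^ (1 - p))) + 3 * A * (n : ℝ) ^ (1 - p) := by gcongr
      _ = _ := by ring

/-- Comparison of consecutive level sets: either the counts are comparable, or the smaller one is
absorbed. -/
theorem sq_mul_card_rpow_le_add_half {d : ℕ} (hd : 3 ≤ d) {τ E : ℝ≥0∞} {n n' : ℕ}
    (h : (τ * (n : ℝ≥0∞) ^ (1 - (1 : ℝ) / d)) ^ 2 ≤ 2 * d * n' * E) :
    (2 * τ) ^ 2 * (n : ℝ≥0∞) ^ (1 - (2 : ℝ) / d) ≤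
      4096 * d * E + τ ^ 2 * (n' : ℝ≥0∞) ^ (1 - (2 : ℝ) / d) / 2 := by
  have hd' : (3 : ℝ) ≤ d := by exact_mod_cast hd
  set q : ℝ := 1 - (2 : ℝ) / d
  have hq : 1 / 3 ≤ q := by
    have : (2 : ℝ) / d ≤ 2 / 3 := by gcongr
    simp only [q]
    linarith
  have hq0 : 0 < q := by linarith
  rcases Nat.eq_zero_or_pos n with rfl | hn
  · simp [ENNReal.zero_rpow_of_pos hq0]
  have hn0 : (n : ℝ≥0∞) ≠ 0 := by simpa using hn.ne'
  have hnt : (n : ℝ≥0∞) ≠ ∞ := ENNReal.natCast_ne_top n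
  by_cases hcase : n' ≤ 512 * n
  · refine le_trans ?_ le_self_add
    have hpow : ((n : ℝ≥0∞) ^ (1 - (1 : ℝ) / d)) ^ 2 = (n : ℝ≥0∞) ^ q * n := by
      rw [← ENNReal.rpow_natCast, ← ENNReal.rpow_mul]
      nth_rewrite 3 [← ENNReal.rpow_one (n : ℝ≥0∞)]
      rw [← ENNReal.rpow_add _ _ hn0 hnt]
      congr 1
      simp only [q]
      push_cast
      ring
    rw [mul_pow, hpow, ← mul_assoc] at h
    have h' : τ ^ 2 * (n : ℝ≥0∞) ^ q * n ≤ 1024 * d * E * n := by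
      refine h.trans ?_
      have : (n' : ℝ≥0∞) ≤ 512 * n := by exact_mod_cast hcase
      calc 2 * d * n' * E ≤ 2 * d * (512 * n) * E := by gcongr
        _ = _ := by ring
    have h'' := (ENNReal.mul_le_mul_iff_left hn0 hnt).1 h'
    calc (2 * τ) ^ 2 * (n : ℝ≥0∞) ^ q = 4 * (τ ^ 2 * (n : ℝ≥0∞) ^ q) := by ring
      _ ≤ 4 * (1024 * d * E) := by gcongr
      _ = _ := by ring
  · refine le_trans ?_ le_add_self
    have h8 : (8 : ℝ≥0∞) ≤ 512 ^ q := by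
      calc (8 : ℝ≥0∞) = (8 ^ (3 : ℝ)) ^ (1 / 3 : ℝ) := by
            rw [← ENNReal.rpow_mul]; norm_num
        _ = 512 ^ (1 / 3 : ℝ) := by norm_num
        _ ≤ _ := ENNReal.rpow_le_rpow_of_exponent_le (by norm_num) hq
    have hnn : 8 * (n : ℝ≥0∞) ^ q ≤ (n' : ℝ≥0∞) ^ q := by
      calc 8 * (n : ℝ≥0∞) ^ q ≤ 512 ^ q * (n : ℝ≥0∞) ^ q := by gcongr
        _ = (512 * n) ^ q := (ENNReal.mul_rpow_of_nonneg _ _ hq0.le).symm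
        _ ≤ _ := by
          refine ENNReal.rpow_le_rpow ?_ hq0.le
          exact_mod_cast (not_le.1 hcase).le
    rw [ENNReal.le_div_iff_mul_le (by simp) (by simp)]
    calc (2 * τ) ^ 2 * (n : ℝ≥0∞) ^ q * 2 = τ ^ 2 * (8 * (n : ℝ≥0∞) ^ q) := by ring
      _ ≤ _ := by gcongr

/-- A dyadic form of the Lorentz-scale Sobolev inequality on `ℤ^d`. -/
theorem tsum_level_card_rpow_le {d : ℕ} (hd : 3 ≤ d) {v : (Fin d → ℤ) → ℝ}
    (S : Finset (Fin d → ℤ)) (hS : ∀ x, x ∉ S → v x = 0) {m : ℝ} (hm : 0 ≤ m) :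
    ∑' k : ℕ, ENNReal.ofReal (m * 2⁻¹ ^ k) ^ 2 *
        ((S.filter fun x => m * 2⁻¹ ^ k < v x).card : ℝ≥0∞) ^ (1 - (2 : ℝ) / d) ≤
      8192 * d * ∑' x, ∑ j, edist (v (x + latUnit d j)) (v x) ^ 2 := by
  have hd' : (3 : ℝ) ≤ d := by exact_mod_cast hd
  have hq : 0 ≤ 1 - (2 : ℝ) / d := by
    have : (2 : ℝ) / d ≤ 2 / 3 := by gcongr
    linarith
  set t : ℕ → ℝ := fun k => m * 2⁻¹ ^ k
  have ht0 : ∀ k, 0 ≤ t k := fun k => by positivity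
  have htk : ∀ k, t k = 2 * t (k + 1) := fun k => by simp only [t]; ring
  have htanti : Antitone t := antitone_nat_of_succ_le fun k => by
    have := ht0 (k + 1)
    linarith [htk k]
  set K : ℕ → Finset (Fin d → ℤ) := fun k => S.filter fun x => t k < v x
  set a : ℕ → ℝ≥0∞ := fun k =>
    ENNReal.ofReal (t k) ^ 2 * ((K k).card : ℝ≥0∞) ^ (1 - (2 : ℝ) / d) with ha
  change ∑' k, a k ≤ _
  set T : ℕ → (Fin d → ℤ) → ℝ := fun k x => min (v x) (t k) - min (v x) (t (k + 1))
  set E : ℕ → ℝ≥0∞ := fun k => ∑' x, ∑ j, edist (T k (x + latUnit d j)) (T k x) ^ 2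
  have hoff : ∀ k x, x ∉ K k → v x ≤ t k := by
    intro k x hx
    by_cases hxS : x ∈ S
    · by_contra! hlt
      exact hx (Finset.mem_filter.2 ⟨hxS, hlt⟩)
    · rw [hS x hxS]
      exact ht0 k
  have hT0 : ∀ k x, x ∉ K (k + 1) → T k x = 0 := by
    intro k x hx
    have h1 := hoff _ x hx
    simp only [T]
    rw [min_eq_left h1, min_eq_left (h1.trans (htanti (Nat.le_succ k))), sub_self]
  have hstep : ∀ k, a k ≤ 4096 * d * E k + a (k + 1) / 2 := by
    intro k
    have h1 := mul_card_rpow_le_tsum_edist (by omega : 2 ≤ d)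
      ((K (k + 1)).finite_toSet.subset fun x hx => by
        by_contra h
        exact hx (hT0 k x h)) (K k) (ENNReal.ofReal (t (k + 1))) fun x hx => by
          have h2 : t k < v x := (Finset.mem_filter.1 hx).2
          have h3 : T k x = t (k + 1) := by
            simp only [T]
            rw [min_eq_right h2.le, min_eq_right ((htanti (Nat.le_add_right k 1)).trans h2.le)]
            linarith [htk k]
          rw [h3, edist_dist, Real.dist_0_eq_abs, abs_of_nonneg (ht0 _)]
    have h2 := sq_mul_card_rpow_le_add_half hd 
      ((pow_le_pow_left' h1 2).trans (sq_tsum_edist_le _ (hT0 k)))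
    have h3 : ENNReal.ofReal (t k) = 2 * ENNReal.ofReal (t (k + 1)) := by
      rw [htk k, ENNReal.ofReal_mul (by norm_num), ENNReal.ofReal_ofNat]
    simp only [ha]
    rw [h3]
    exact h2
  have hEsum : ∑' k, E k ≤ ∑' x, ∑ j, edist (v (x + latUnit d j)) (v x) ^ 2 := by
    simp only [E]
    rw [ENNReal.tsum_comm]
    refine ENNReal.tsum_le_tsum fun x => ?_
    rw [Summable.tsum_finsetSum fun _ _ => ENNReal.summable]
    exact Finset.sum_le_sum fun j _ => tsum_edist_truncation_sq_le htanti _ _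
  have hfin : ∑' k, a k ≠ ∞ := by
    have hle : ∀ k, a k ≤ ENNReal.ofReal m ^ 2 * (S.card : ℝ≥0∞) ^ (1 - (2 : ℝ) / d) * 2⁻¹ ^ k := by
      intro k
      have h1 : ((K k).card : ℝ≥0∞) ≤ S.card := by
        exact_mod_cast Finset.card_filter_le _ _
      have h2 : ENNReal.ofReal (t k) = ENNReal.ofReal m * 2⁻¹ ^ k := by
        simp only [t]
        rw [ENNReal.ofReal_mul hm, ENNReal.ofReal_pow (by norm_num),
          ENNReal.ofReal_inv_of_pos (by norm_num), ENNReal.ofReal_ofNat]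
      have h3 : ((2⁻¹ : ℝ≥0∞) ^ k) ^ 2 ≤ 2⁻¹ ^ k :=
        pow_le_of_le_one zero_le (pow_le_one' (by simp) k) two_ne_zero
      calc a k = ENNReal.ofReal m ^ 2 * ((K k).card : ℝ≥0∞) ^ (1 - (2 : ℝ) / d) *
            (2⁻¹ ^ k) ^ 2 := by simp only [ha, h2]; ring
        _ ≤ _ := by gcongr
    refine ne_top_of_le_ne_top ?_ (ENNReal.tsum_le_tsum hle)
    rw [ENNReal.tsum_mul_left, ENNReal.tsum_geometric_two]
    exact ENNReal.mul_ne_top (ENNReal.mul_ne_top (by simp)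
      (ENNReal.rpow_ne_top_of_nonneg hq (ENNReal.natCast_ne_top _))) (by simp)
  set s : ℝ≥0∞ := ∑' k, a k
  have hs : s ≤ 4096 * d * (∑' k, E k) + s / 2 := by
    calc s ≤ ∑' k, (4096 * d * E k + a (k + 1) / 2) := ENNReal.tsum_le_tsum hstep
      _ = 4096 * d * (∑' k, E k) + (∑' k, a (k + 1)) / 2 := by
          rw [ENNReal.tsum_add, ENNReal.tsum_mul_left]
          simp_rw [div_eq_mul_inv]
          rw [ENNReal.tsum_mul_right]
      _ ≤ _ := by
          gcongr
          exact ENNReal.tsum_comp_le_tsum_of_injective (add_left_injective 1) a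
  have hhalf : s / 2 ≤ 4096 * d * ∑' k, E k := by
    refine (ENNReal.add_le_add_iff_right (a := s / 2) (ENNReal.div_ne_top hfin (by simp))).1 ?_
    rwa [ENNReal.add_halves]
  calc s = 2 * (s / 2) := (ENNReal.mul_div_cancel (by simp) (by simp)).symm
    _ ≤ 2 * (4096 * d * ∑' k, E k) := by gcongr
    _ = 8192 * d * ∑' k, E k := by ring
    _ ≤ _ := by gcongr

theorem exists_dyadic_between {m y : ℝ} (hy : 0 < y) (hym : y ≤ m) :
    ∃ k : ℕ, m * 2⁻¹ ^ (k + 1) < y ∧ y ≤ m * 2⁻¹ ^ k := by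
  have hm : 0 < m := hy.trans_le hym
  obtain ⟨k, h1, h2⟩ := exists_nat_pow_near_of_lt_one (div_pos hy hm) ((div_le_one hm).2 hym)
    (by norm_num : (0 : ℝ) < 2⁻¹) (by norm_num)
  rw [lt_div_iff₀ hm] at h1
  rw [div_le_iff₀ hm] at h2
  exact ⟨k, by linarith, by linarith⟩

/-- any `W` in the weak class `ℓ_{d/2,w}(ℤ^d)` with quasi-norm (bounded
by) `A` is a discrete Hardy weight with constant at most `C·A`, `C = C(d)`. -/
theorem weak_class_hardy (d : ℕ) (hd : 3 ≤ d) :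
    ∃ C : ℝ, 0 < C ∧
      ∀ W : (Fin d → ℤ) → ℝ, (∀ x, 0 ≤ W x) →
      (∀ s : ℝ, 0 < s → {x : Fin d → ℤ | s < W x}.Finite) →
      ∀ A : ℝ,
      (∀ s : ℝ, 0 < s →
        s * (({x : Fin d → ℤ | s < W x}.ncard : ℝ)) ^ ((2 : ℝ) / d) ≤ A) →
      ∀ u : (Fin d → ℤ) → ℂ, (Function.support u).Finite →
        (∑' x : Fin d → ℤ, ENNReal.ofReal (W x) * ((‖u x‖₊ : ℝ≥0∞)) ^ 2) ≤
          ENNReal.ofReal (C * A) * Q0 u := by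
  classical
  have hd' : (3 : ℝ) ≤ d := by exact_mod_cast hd
  have hp0 : 0 ≤ (2 : ℝ) / d := by positivity
  have hp : (2 : ℝ) / d ≤ 2 / 3 := by gcongr
  refine ⟨98304 * d, by positivity, fun W hW hfin A hA u hu => ?_⟩
  have hA0 : 0 ≤ A := le_trans (by positivity) (hA 1 one_pos)
  set S := hu.toFinset
  have hS : ∀ x, x ∉ S → ‖u x‖ = 0 := fun x hx => by simpa [S] using hx
  set m : ℝ := ∑ x ∈ S, ‖u x‖
  have hm : 0 ≤ m := Finset.sum_nonneg fun _ _ => norm_nonneg _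
  set K : ℕ → Finset (Fin d → ℤ) := fun k => S.filter fun x => m * 2⁻¹ ^ k < ‖u x‖
  have hlevel := tsum_level_card_rpow_le hd S hS hm
  have hpoint : ∀ x, ENNReal.ofReal (W x) * (‖u x‖₊ : ℝ≥0∞) ^ 2 ≤
      ∑' k : ℕ, if x ∈ K (k + 1) then
        ENNReal.ofReal (m * 2⁻¹ ^ k) ^ 2 * ENNReal.ofReal (W x) else 0 := by
    intro x
    by_cases hx : x ∈ S
    · have hpos : 0 < ‖u x‖ := by simpa [S] using hx
      obtain ⟨k, hk1, hk2⟩ := exists_dyadic_between hpos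
        (Finset.single_le_sum (f := fun x => ‖u x‖) (fun _ _ => norm_nonneg _) hx)
      refine le_trans ?_ (ENNReal.le_tsum k)
      rw [if_pos (Finset.mem_filter.2 ⟨hx, hk1⟩), mul_comm]
      gcongr
      rw [← enorm_eq_nnnorm, ← ofReal_norm]
      exact ENNReal.ofReal_le_ofReal hk2
    · have h0 : u x = 0 := by simpa using hS x hx
      simp [h0]
  have hterm : ∀ k : ℕ, (∑' x, if x ∈ K (k + 1) then
        ENNReal.ofReal (m * 2⁻¹ ^ k) ^ 2 * ENNReal.ofReal (W x) else 0) ≤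
      ENNReal.ofReal (12 * A) * (ENNReal.ofReal (m * 2⁻¹ ^ (k + 1)) ^ 2 *
        ((K (k + 1)).card : ℝ≥0∞) ^ (1 - (2 : ℝ) / d)) := by
    intro k
    rw [tsum_eq_sum (s := K (k + 1)) fun x hx => if_neg hx,
      Finset.sum_congr rfl fun x hx => if_pos hx, ← Finset.mul_sum,
      ← ENNReal.ofReal_sum_of_nonneg fun x _ => hW x]
    have h1 := ENNReal.ofReal_le_ofReal (sum_le_of_weak_class hp0 hp hfin hA (K (k + 1)))
    rw [ENNReal.ofReal_mul (by positivity),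
      ← ENNReal.ofReal_rpow_of_nonneg (by positivity) (by linarith),
      ENNReal.ofReal_natCast] at h1
    have h2 : m * 2⁻¹ ^ k = 2 * (m * 2⁻¹ ^ (k + 1)) := by ring
    have h3 : ENNReal.ofReal (12 * A) = 4 * ENNReal.ofReal (3 * A) := by
      rw [← ENNReal.ofReal_ofNat 4, ← ENNReal.ofReal_mul (by norm_num)]
      congr 1
      ring
    rw [h2, ENNReal.ofReal_mul (by norm_num), ENNReal.ofReal_ofNat, h3]
    refine (mul_le_mul_right h1 _).trans (le_of_eq ?_)
    ring
  calc _ ≤ ∑' x, ∑' k : ℕ, (if x ∈ K (k + 1) then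
        ENNReal.ofReal (m * 2⁻¹ ^ k) ^ 2 * ENNReal.ofReal (W x) else 0) :=
        ENNReal.tsum_le_tsum hpoint
    _ ≤ ∑' k : ℕ, ENNReal.ofReal (12 * A) * (ENNReal.ofReal (m * 2⁻¹ ^ (k + 1)) ^ 2 *
        ((K (k + 1)).card : ℝ≥0∞) ^ (1 - (2 : ℝ) / d)) := by
        rw [ENNReal.tsum_comm]
        exact ENNReal.tsum_le_tsum hterm
    _ ≤ ENNReal.ofReal (12 * A) *
        (8192 * d * ∑' x, ∑ j, edist ‖u (x + latUnit d j)‖ ‖u x‖ ^ 2) := by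
        rw [ENNReal.tsum_mul_left]
        gcongr
        exact (ENNReal.tsum_comp_le_tsum_of_injective (add_left_injective 1)
          fun k : ℕ => ENNReal.ofReal (m * 2⁻¹ ^ k) ^ 2 *
            ((K k).card : ℝ≥0∞) ^ (1 - (2 : ℝ) / d)).trans hlevel
    _ ≤ ENNReal.ofReal (12 * A) * (8192 * d * Q0 u) := by
        refine mul_le_mul_right (mul_le_mul_right (ENNReal.tsum_le_tsum fun x =>
          Finset.sum_le_sum fun j _ => pow_le_pow_left' ?_ 2) _) _
        rw [edist_nndist]
        exact_mod_cast nndist_nnnorm_nnnorm_le (u (x + latUnit d j)) (u x)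
    _ = _ := by
        have h : 98304 * (d : ℝ) * A = 12 * A * ((8192 * d : ℕ) : ℝ) := by
          push_cast
          ring
        rw [h, ENNReal.ofReal_mul (p := 12 * A) (by positivity), ENNReal.ofReal_natCast, ← mul_assoc]
        push_cast
        rfl
end
end
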